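/- Let θ be a refinement of μ whose n-th component is (1,…,1), and let η be a refinement of θ (so S_η ⊆ S_θ and B_θ ⊆ B_η). Then L_η equals the B_η-submodule of V_K generated by L_θ, i.e. L_η = B_η·L_θ. Consequently, for any fully critical v with singularity η, the natural ℂ-linear map ℂ_v ⊗_{B_θ} L_θ → ℂ_v ⊗_{B_η} L_η induced by the inclusion L_θ ⊆ L_η is an isomorphism of vector spaces. -/

import Mathlib

open scoped BigOperators

set_option maxHeartbeats 1000000
set_option synthInstance.maxHeartbeats 400000
noncomputable section

namespace GTpaper

variable (r : ℕ) (η : Fin r → ℕ)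

/-- The index set Σ(η): pairs (k,i) with 1 ≤ k ≤ r, 1 ≤ i ≤ η_k (0-based). -/
abbrev Idx := (k : Fin r) × Fin (η k)

/-- The polynomial ring ℂ[X_η]. -/
abbrev Pol := MvPolynomial (Idx r η) ℂ

/-- The field of rational functions F = ℂ(X_η). -/
abbrev FF := FractionRing (Pol r η)

/-- The group S_η = S_{η_1} × ⋯ × S_{η_r}. -/
abbrev Sg := ∀ k : Fin r, Equiv.Perm (Fin (η k))

/-- The action of S_η on the index set. -/
def permIdx (σ : Sg r η) : Equiv.Perm (Idx r η) where
  toFun p := ⟨p.1, σ p.1 p.2⟩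
  invFun p := ⟨p.1, (σ p.1)⁻¹ p.2⟩
  left_inv p := by simp
  right_inv p := by simp

/-- The action of S_η on ℂ[X_η] by permuting variables. -/
def actP (σ : Sg r η) : Pol r η ≃+* Pol r η :=
  (MvPolynomial.renameEquiv ℂ (permIdx r η σ)).toRingEquiv

/-- The action of S_η on F = ℂ(X_η) by field automorphisms. -/
def actF (σ : Sg r η) : FF r η ≃+* FF r η :=
  IsFractionRing.ringEquivOfRingEquiv (actP r η σ)

/-- The variable x_{k,i} viewed as an element of F. -/
def XF (p : Idx r η) : FF r η := algebraMap (Pol r η) (FF r η) (MvPolynomial.X p)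

/-- The element of S_η which transposes (k,i) and (k,j) and fixes all other indices. -/
def transpT (k : Fin r) (i j : Fin (η k)) : Sg r η :=
  Function.update (1 : Sg r η) k (Equiv.swap i j)

/-- The simple transposition s_i^{(k)}. -/
def simpleT (k : Fin r) (i : ℕ) (h : i + 1 < η k) : Sg r η :=
  transpT r η k ⟨i, Nat.lt_of_succ_lt h⟩ ⟨i + 1, h⟩

/-- The divided difference operator ∂_i^{(k)} on F. -/
def dd (k : Fin r) (i : ℕ) (h : i + 1 < η k) (f : FF r η) : FF r η :=
  (f - actF r η (simpleT r η k i h) f) /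
    (XF r η ⟨k, ⟨i, Nat.lt_of_succ_lt h⟩⟩ - XF r η ⟨k, ⟨i + 1, h⟩⟩)

/-- Data indexing a simple transposition of S_η. -/
abbrev SimpleDat := (k : Fin r) × {i : ℕ // i + 1 < η k}

/-- A word in the simple transpositions of S_η. -/
abbrev Word := List (SimpleDat r η)

/-- The element of S_η represented by a word. -/
def wordPerm (w : Word r η) : Sg r η :=
  (w.map fun s => simpleT r η s.1 s.2.1 s.2.2).prod

/-- The composite ∂_{j_1} ∘ ⋯ ∘ ∂_{j_l} of divided differences along a word. -/
def ddWord (w : Word r η) (f : FF r η) : FF r η :=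
  w.foldr (fun s g => dd r η s.1 s.2.1 s.2.2 g) f

/-- The length ℓ(σ): the total number of inversions of σ. -/
def len (σ : Sg r η) : ℕ :=
  ∑ k : Fin r,
    (Finset.univ.filter fun p : Fin (η k) × Fin (η k) => p.1 < p.2 ∧ σ k p.2 < σ k p.1).card

/-- `w` is a reduced decomposition of σ. -/
def IsRed (σ : Sg r η) (w : Word r η) : Prop :=
  wordPerm r η w = σ ∧ w.length = len r η σ

/-- The longest word w_η of S_η. -/
def wEta : Sg r η := fun _ => Fin.revPerm

/-- η! = η_1! ⋯ η_r!. -/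
def etaFact : ℕ := ∏ k : Fin r, Nat.factorial (η k)

/-- The Vandermonde-type product Δ_η as a polynomial. -/
def DeltaP : Pol r η :=
  ∏ k : Fin r, ∏ p ∈ Finset.univ.filter (fun p : Fin (η k) × Fin (η k) => p.1 < p.2),
    (MvPolynomial.X (⟨k, p.1⟩ : Idx r η) - MvPolynomial.X (⟨k, p.2⟩ : Idx r η))

/-- Δ_η as an element of F. -/
def DeltaF : FF r η := algebraMap (Pol r η) (FF r η) (DeltaP r η)

/-- The symmetrization operator sym_η on F. -/
def symF (f : FF r η) : FF r η :=
  (etaFact r η : FF r η)⁻¹ * ∑ σ : Sg r η, actF r η σ f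

/-- The sign of an element of S_η. -/
def sgn (σ : Sg r η) : ℤ := ∏ k : Fin r, (Equiv.Perm.sign (σ k) : ℤ)

/-- The antisymmetrization operator asym_η on F. -/
def asymF (f : FF r η) : FF r η :=
  (etaFact r η : FF r η)⁻¹ * ∑ σ : Sg r η, (sgn r η σ : FF r η) * actF r η σ f

/-- The ideal p_η of ℂ[X_η] generated by the differences x_{k,i} - x_{k,j}. -/
def pIdeal : Ideal (Pol r η) :=
  Ideal.span {q | ∃ (k : Fin r) (i j : Fin (η k)), i < j ∧
    q = MvPolynomial.X (⟨k, i⟩ : Idx r η) - MvPolynomial.X (⟨k, j⟩ : Idx r η)}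

/-! ### The Gelfand–Tsetlin setting: μ = (1,2,…,n) -/

/-- The composition μ = (1,2,…,n) (0-based: row k has k+1 entries). -/
abbrev mEta (n : ℕ) : Fin n → ℕ := fun k => (k : ℕ) + 1

/-- The index set of Gelfand–Tsetlin tableaux entries. -/
abbrev IdxN (n : ℕ) := Idx n (mEta n)

/-- The polynomial ring ℂ[X_μ]. -/
abbrev PolN (n : ℕ) := Pol n (mEta n)

/-- The field K = ℂ(X_μ). -/
abbrev KK (n : ℕ) := FF n (mEta n)

/-- The group S_μ = S_1 × S_2 × ⋯ × S_n. -/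
abbrev SgN (n : ℕ) := Sg n (mEta n)

variable (n : ℕ)

/-- The additive group ℤ^μ_0 of integral μ-points with vanishing top row. -/
def Z0sub : AddSubgroup (IdxN n → ℤ) where
  carrier := {z | ∀ p : IdxN n, (p.1 : ℕ) + 1 = n → z p = 0}
  add_mem' := by intro a b ha hb p hp; simp [ha p hp, hb p hp]
  zero_mem' := by intro p _; rfl
  neg_mem' := by intro a ha p hp; simp [ha p hp]

abbrev Z0 := ↥(Z0sub n)

/-- The K-vector space V_K with basis {T(z) : z ∈ ℤ^μ_0}. -/
def VK : Type := Z0 n →₀ KK n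

instance : AddCommGroup (VK n) := inferInstanceAs (AddCommGroup (Z0 n →₀ KK n))
instance : Module (KK n) (VK n) := inferInstanceAs (Module (KK n) (Z0 n →₀ KK n))
instance : Module ℂ (VK n) := inferInstanceAs (Module ℂ (Z0 n →₀ KK n))
instance : IsScalarTower ℂ (KK n) (VK n) :=
  inferInstanceAs (IsScalarTower ℂ (KK n) (Z0 n →₀ KK n))
instance : SMulCommClass (KK n) (KK n) (VK n) :=
  inferInstanceAs (SMulCommClass (KK n) (KK n) (Z0 n →₀ KK n))

/-- The tableau T(z), as a basis vector of V_K. -/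
def T (z : Z0 n) : VK n := Finsupp.single z 1

/-- The translation automorphism f(x) ↦ f(x+z) of ℂ[X_μ]. -/
def shiftP (z : IdxN n → ℤ) : PolN n ≃ₐ[ℂ] PolN n :=
  AlgEquiv.ofAlgHom
    (MvPolynomial.aeval fun p => MvPolynomial.X p + MvPolynomial.C ((z p : ℤ) : ℂ))
    (MvPolynomial.aeval fun p => MvPolynomial.X p - MvPolynomial.C ((z p : ℤ) : ℂ))
    (by apply MvPolynomial.algHom_ext; intro p; simp)
    (by apply MvPolynomial.algHom_ext; intro p; simp)

/-- The translation automorphism f(x) ↦ f(x+z) of K = ℂ(X_μ). -/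
def shiftK (z : IdxN n → ℤ) : KK n ≃+* KK n :=
  IsFractionRing.ringEquivOfRingEquiv (shiftP n z).toRingEquiv

/-- The tuple δ^{k,i} ∈ ℤ^μ_0. -/
def deltaZ (k : ℕ) (hk : k + 1 < n) (i : Fin (k + 1)) : Z0 n :=
  ⟨Pi.single (⟨⟨k, Nat.lt_of_succ_lt hk⟩, i⟩ : IdxN n) (1 : ℤ), by
    intro p hp
    rw [Pi.single_apply]
    have : p ≠ (⟨⟨k, Nat.lt_of_succ_lt hk⟩, i⟩ : IdxN n) := by
      intro h; rw [h] at hp; simp at hp; omega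
    simp [this]⟩

/-- The Gelfand–Tsetlin function e⁺_{k,i} ∈ K (0-based row k, 0 ≤ k ≤ n-2). -/
def ePlus (k : ℕ) (hk : k + 1 < n) (i : Fin (k + 1)) : KK n :=
  (∏ j : Fin (k + 2),
      (XF n (mEta n) ⟨⟨k, Nat.lt_of_succ_lt hk⟩, i⟩ - XF n (mEta n) ⟨⟨k + 1, hk⟩, j⟩)) /
  (∏ j ∈ Finset.univ.erase i,
      (XF n (mEta n) ⟨⟨k, Nat.lt_of_succ_lt hk⟩, i⟩ -
        XF n (mEta n) ⟨⟨k, Nat.lt_of_succ_lt hk⟩, j⟩))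

/-- The Gelfand–Tsetlin function e⁻_{k,i} ∈ K (0-based row k, 0 ≤ k ≤ n-2). -/
def eMinus (k : ℕ) (hk : k + 1 < n) (i : Fin (k + 1)) : KK n :=
  (∏ j : Fin k,
      (XF n (mEta n) ⟨⟨k, Nat.lt_of_succ_lt hk⟩, i⟩ -
        XF n (mEta n) ⟨⟨k - 1, by omega⟩, Fin.castLE (by simp only [mEta]; omega) j⟩)) /
  (∏ j ∈ Finset.univ.erase i,
      (XF n (mEta n) ⟨⟨k, Nat.lt_of_succ_lt hk⟩, i⟩ -
        XF n (mEta n) ⟨⟨k, Nat.lt_of_succ_lt hk⟩, j⟩))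

/-- The Gelfand–Tsetlin operator E_{k,k+1} (0-based: matrix unit (k, k+1)). -/
def Eop (k : ℕ) (hk : k + 1 < n) : Module.End (KK n) (VK n) :=
  Finsupp.lsum (KK n) fun z => LinearMap.toSpanSingleton (KK n) (VK n)
    (-∑ i : Fin (k + 1),
      shiftK n (z : IdxN n → ℤ) (ePlus n k hk i) • T n (z + deltaZ n k hk i))

/-- The Gelfand–Tsetlin operator E_{k+1,k} (0-based: matrix unit (k+1, k)). -/
def Fop (k : ℕ) (hk : k + 1 < n) : Module.End (KK n) (VK n) :=
  Finsupp.lsum (KK n) fun z => LinearMap.toSpanSingleton (KK n) (VK n)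
    (∑ i : Fin (k + 1),
      shiftK n (z : IdxN n → ℤ) (eMinus n k hk i) • T n (z - deltaZ n k hk i))

/-- The Gelfand–Tsetlin operator E_{k,k} (0-based row k of the diagonal). -/
def Hop (k : Fin n) : Module.End (KK n) (VK n) :=
  Finsupp.lsum (KK n) fun z => LinearMap.toSpanSingleton (KK n) (VK n)
    (((∑ j : Fin ((k : ℕ) + 1),
        (XF n (mEta n) ⟨k, j⟩ + ((z : IdxN n → ℤ) ⟨k, j⟩ : KK n))) -
      (∑ j : Fin (k : ℕ),
        (XF n (mEta n) ⟨⟨(k : ℕ) - 1, by omega⟩, Fin.castLE (by simp only [mEta]; omega) j⟩ +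
          ((z : IdxN n → ℤ) ⟨⟨(k : ℕ) - 1, by omega⟩, Fin.castLE (by simp only [mEta]; omega) j⟩ : KK n))) +
      ((k : ℕ) : KK n)) • T n z)

/-- The action of S_μ on ℤ^μ_0. -/
def permZ0 (σ : SgN n) : Z0 n ≃ Z0 n where
  toFun z := ⟨fun p => (z : IdxN n → ℤ) ((permIdx n (mEta n) σ).symm p), by
    intro p hp
    exact z.2 ((permIdx n (mEta n) σ).symm p) hp⟩
  invFun z := ⟨fun p => (z : IdxN n → ℤ) (permIdx n (mEta n) σ p), by
    intro p hp
    exact z.2 (permIdx n (mEta n) σ p) hp⟩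
  left_inv z := by ext p; simp
  right_inv z := by ext p; simp

/-- The diagonal action of S_μ on V_K : σ·(f T(z)) = σ(f) T(σ(z)). -/
def sact (σ : SgN n) (w : VK n) : VK n :=
  Finsupp.equivMapDomain (permZ0 n σ) (Finsupp.mapRange (actF n (mEta n) σ) (map_zero _) w)
/-! ### Refinements η of μ, given by a block function on the index set -/

variable (blk : IdxN n → ℕ)

/-- The subgroup S_η ⊆ S_μ of permutations preserving each η-block. -/
def SgEta : Subgroup (SgN n) where
  carrier := {σ | ∀ p : IdxN n, blk (permIdx n (mEta n) σ p) = blk p}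
  one_mem' := fun _ => rfl
  mul_mem' := by
    intro a b ha hb p
    exact (ha (permIdx n (mEta n) b p)).trans (hb p)
  inv_mem' := by
    intro a ha p
    have h := ha (permIdx n (mEta n) a⁻¹ p)
    simpa [permIdx] using h.symm

/-- η! : the order of S_η (the product of the factorials of the parts of η). -/
def etaFactB : ℕ := Nat.card ↥(SgEta n blk)

/-- The symmetrization operator sym_η on K. -/
noncomputable def symK (f : KK n) : KK n :=
  haveI : Fintype ↥(SgEta n blk) := Fintype.ofFinite _
  (etaFactB n blk : KK n)⁻¹ * ∑ τ : ↥(SgEta n blk), actF n (mEta n) (τ : SgN n) f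

/-- The symmetrization operator sym_η on V_K (for the diagonal action). -/
noncomputable def symV (x : VK n) : VK n :=
  haveI : Fintype ↥(SgEta n blk) := Fintype.ofFinite _
  (etaFactB n blk : KK n)⁻¹ • ∑ τ : ↥(SgEta n blk), sact n (τ : SgN n) x

/-- The divided difference operator ∂_i^{(k)} acting on V_K via the diagonal action. -/
noncomputable def ddV (k : Fin n) (i : ℕ) (h : i + 1 < mEta n k) (x : VK n) : VK n :=
  (XF n (mEta n) ⟨k, ⟨i, Nat.lt_of_succ_lt h⟩⟩ - XF n (mEta n) ⟨k, ⟨i + 1, h⟩⟩)⁻¹ •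
    (x - sact n (simpleT n (mEta n) k i h) x)

/-- The composite of divided differences on V_K along a word. -/
noncomputable def ddWordV (w : Word n (mEta n)) (x : VK n) : VK n :=
  w.foldr (fun s g => ddV n s.1 s.2.1 s.2.2 g) x

/-- All letters of the word are simple transpositions inside η-blocks (i.e. lie in S_η). -/
def WordBlk (w : Word n (mEta n)) : Prop :=
  ∀ s ∈ w, blk ⟨s.1, ⟨s.2.1, Nat.lt_of_succ_lt s.2.2⟩⟩ = blk ⟨s.1, ⟨s.2.1 + 1, s.2.2⟩⟩

/-- `w` is a reduced decomposition of σ into simple transpositions of S_η. -/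
def IsRedB (σ : SgN n) (w : Word n (mEta n)) : Prop :=
  IsRed n (mEta n) σ w ∧ WordBlk n blk w

/-- The multiplicative set of ℂ[X_μ] generated by the x_{k,i} − x_{k,j} − c (c a nonzero
integer, row k below the top) and by the x_{k,i} − x_{k,j} with (k,i), (k,j) in different
η-blocks. -/
def BMon : Submonoid (PolN n) :=
  Submonoid.closure
    ({q | ∃ (k : Fin n) (i j : Fin ((k : ℕ) + 1)) (c : ℤ), (k : ℕ) + 1 < n ∧ i < j ∧ c ≠ 0 ∧
        q = MvPolynomial.X (⟨k, i⟩ : IdxN n) - MvPolynomial.X (⟨k, j⟩ : IdxN n) -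
          MvPolynomial.C (c : ℂ)} ∪
     {q | ∃ (k : Fin n) (i j : Fin ((k : ℕ) + 1)), blk ⟨k, i⟩ ≠ blk ⟨k, j⟩ ∧
        q = MvPolynomial.X (⟨k, i⟩ : IdxN n) - MvPolynomial.X (⟨k, j⟩ : IdxN n)})

/-- The algebra B_η ⊆ K : the localization of ℂ[X_μ] at the multiplicative set `BMon`,
viewed as the subalgebra of K of fractions with denominator in `BMon`. -/
def Balg : Subalgebra ℂ (KK n) where
  carrier := {f | ∃ p : PolN n, ∃ q ∈ BMon n blk,
    f * algebraMap (PolN n) (KK n) q = algebraMap (PolN n) (KK n) p}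
  mul_mem' := by
    rintro f g ⟨p₁, q₁, hq₁, h₁⟩ ⟨p₂, q₂, hq₂, h₂⟩
    refine ⟨p₁ * p₂, q₁ * q₂, mul_mem hq₁ hq₂, ?_⟩
    have : f * g * algebraMap (PolN n) (KK n) (q₁ * q₂) =
        (f * algebraMap (PolN n) (KK n) q₁) * (g * algebraMap (PolN n) (KK n) q₂) := by
      rw [map_mul]; ring
    rw [this, h₁, h₂, ← map_mul]
  one_mem' := ⟨1, 1, one_mem _, by simp⟩
  add_mem' := by
    rintro f g ⟨p₁, q₁, hq₁, h₁⟩ ⟨p₂, q₂, hq₂, h₂⟩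
    refine ⟨p₁ * q₂ + p₂ * q₁, q₁ * q₂, mul_mem hq₁ hq₂, ?_⟩
    have : (f + g) * algebraMap (PolN n) (KK n) (q₁ * q₂) =
        (f * algebraMap (PolN n) (KK n) q₁) * algebraMap (PolN n) (KK n) q₂ +
        (g * algebraMap (PolN n) (KK n) q₂) * algebraMap (PolN n) (KK n) q₁ := by
      rw [map_mul]; ring
    rw [this, h₁, h₂, ← map_mul, ← map_mul, ← map_add]
  zero_mem' := ⟨0, 1, one_mem _, by simp⟩
  algebraMap_mem' := by
    intro c
    refine ⟨MvPolynomial.C c, 1, one_mem _, ?_⟩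
    rw [map_one, mul_one, IsScalarTower.algebraMap_apply ℂ (PolN n) (KK n)]
    simp [MvPolynomial.algebraMap_eq]

/-- The set N_η of integral points which are weakly decreasing along each η-block
(normal-form representatives of the S_η-orbits). -/
def Nset : Set (Z0 n) :=
  {z | ∀ (k : Fin n) (i j : Fin ((k : ℕ) + 1)), i ≤ j → blk ⟨k, i⟩ = blk ⟨k, j⟩ →
    (z : IdxN n → ℤ) ⟨k, j⟩ ≤ (z : IdxN n → ℤ) ⟨k, i⟩}

/-- σ is an ε(z)-shuffle: σ ∈ S_η and σ is increasing on each ε(z)-block, where ε(z) is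
the refinement of η whose blocks are the runs of equal entries of z inside the η-blocks
(so S_{ε(z)} is the stabilizer of z in S_η). -/
def IsShuffle (z : Z0 n) (σ : SgN n) : Prop :=
  σ ∈ SgEta n blk ∧
    ∀ (k : Fin n) (i j : Fin ((k : ℕ) + 1)), i < j → blk ⟨k, i⟩ = blk ⟨k, j⟩ →
      (z : IdxN n → ℤ) ⟨k, i⟩ = (z : IdxN n → ℤ) ⟨k, j⟩ → σ k i < σ k j

/-- The index set for the basis of derived tableaux. -/
def BIdx : Type :=
  {x : Z0 n × SgN n // x.1 ∈ Nset n blk ∧ IsShuffle n blk x.1 x.2}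

/-- The operator c_γ on V_K, given by c_γ T(z) = γ(x+z) T(z). -/
noncomputable def copN (γ : PolN n) : Module.End (KK n) (VK n) :=
  Finsupp.lsum (KK n) fun z => LinearMap.toSpanSingleton (KK n) (VK n)
    (shiftK n (z : IdxN n → ℤ) (algebraMap (PolN n) (KK n) γ) • T n z)

/-- Evaluation γ(v+z) of a polynomial at the point v + z. -/
noncomputable def evalVZ (v : IdxN n → ℂ) (z : Z0 n) (γ : PolN n) : ℂ :=
  MvPolynomial.eval (fun p => v p + ((z : IdxN n → ℤ) p : ℂ)) γ

section Actions

variable {n : ℕ}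

theorem actP_X (σ : SgN n) (p : IdxN n) :
    actP n (mEta n) σ (MvPolynomial.X p) = MvPolynomial.X (permIdx n (mEta n) σ p) := by
  simp [actP]

theorem actP_C (σ : SgN n) (c : ℂ) :
    actP n (mEta n) σ (MvPolynomial.C c) = MvPolynomial.C c := by
  simp [actP]

theorem actP_mul (σ τ : SgN n) (f : PolN n) :
    actP n (mEta n) (σ * τ) f = actP n (mEta n) σ (actP n (mEta n) τ f) := by
  simp only [actP, AlgEquiv.coe_ringEquiv,
    MvPolynomial.renameEquiv_apply, MvPolynomial.rename_rename]
  rfl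

theorem actF_algebraMap (σ : SgN n) (f : PolN n) :
    actF n (mEta n) σ (algebraMap (PolN n) (KK n) f) =
      algebraMap (PolN n) (KK n) (actP n (mEta n) σ f) := by
  simp [actF]

theorem actF_mul (σ τ : SgN n) (f : KK n) :
    actF n (mEta n) (σ * τ) f = actF n (mEta n) σ (actF n (mEta n) τ f) := by
  obtain ⟨p, q, -, rfl⟩ := IsFractionRing.div_surjective (A := PolN n) f
  simp only [map_div₀, actF_algebraMap, actP_mul]

theorem actF_one (f : KK n) : actF n (mEta n) 1 f = f := by
  have h : actF n (mEta n) 1 (actF n (mEta n) 1 f) = actF n (mEta n) 1 f := by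
    rw [← actF_mul, one_mul]
  exact (actF n (mEta n) 1).injective h

theorem actP_one (f : PolN n) : actP n (mEta n) 1 f = f := by
  have h : actP n (mEta n) 1 (actP n (mEta n) 1 f) = actP n (mEta n) 1 f := by
    rw [← actP_mul, one_mul]
  exact (actP n (mEta n) 1).injective h

/-- The coefficient of a basis tableau in an element of `VK`. -/
def coeffV (z : Z0 n) : VK n →ₗ[KK n] KK n :=
  (Finsupp.lapply z : (Z0 n →₀ KK n) →ₗ[KK n] KK n)

theorem coeffV_sact (σ : SgN n) (w : VK n) (z : Z0 n) :
    coeffV z (sact n σ w) = actF n (mEta n) σ (coeffV ((permZ0 n σ).symm z) w) := rfl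

theorem VK_ext {w w' : VK n} (h : ∀ z : Z0 n, coeffV z w = coeffV z w') : w = w' :=
  Finsupp.ext h

theorem coeffV_T (z y : Z0 n) : coeffV y (T n z) = if z = y then 1 else 0 := by
  classical
  exact Finsupp.single_apply

theorem sact_add (σ : SgN n) (w w' : VK n) :
    sact n σ (w + w') = sact n σ w + sact n σ w' := by
  apply VK_ext
  intro z
  simp only [map_add, coeffV_sact]

theorem sact_smul (σ : SgN n) (f : KK n) (w : VK n) :
    sact n σ (f • w) = actF n (mEta n) σ f • sact n σ w := by
  apply VK_ext
  intro z
  simp only [map_smul, coeffV_sact, smul_eq_mul, map_mul]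

theorem permZ0_mul (σ τ : SgN n) (z : Z0 n) :
    permZ0 n (σ * τ) z = permZ0 n σ (permZ0 n τ z) := rfl

theorem permZ0_one (z : Z0 n) : permZ0 n 1 z = z := rfl

theorem sact_T (σ : SgN n) (z : Z0 n) : sact n σ (T n z) = T n (permZ0 n σ z) := by
  change Finsupp.equivMapDomain (permZ0 n σ) (Finsupp.mapRange _ _ (Finsupp.single z 1)) = _
  rw [Finsupp.mapRange_single, Finsupp.equivMapDomain_single, map_one]
  rfl

theorem sact_mul (σ τ : SgN n) (w : VK n) :
    sact n (σ * τ) w = sact n σ (sact n τ w) := by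
  apply VK_ext
  intro z
  rw [coeffV_sact, coeffV_sact, coeffV_sact, actF_mul]
  rfl

theorem sact_one (w : VK n) : sact n 1 w = w := by
  apply VK_ext
  intro z
  rw [coeffV_sact, actF_one]
  rfl

/-- The diagonal action of a permutation as an additive map. -/
def sactHom (σ : SgN n) : VK n →+ VK n where
  toFun := sact n σ
  map_zero' := by
    have h := sact_add σ (0 : VK n) 0
    rw [add_zero] at h
    exact left_eq_add.mp h
  map_add' := sact_add σ

theorem sact_sub (σ : SgN n) (w w' : VK n) :
    sact n σ (w - w') = sact n σ w - sact n σ w' :=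
  map_sub (sactHom σ) w w'

theorem sact_zero (σ : SgN n) : sact n σ (0 : VK n) = 0 := map_zero (sactHom σ)

end Actions

section Lengths

/-- An adjacent transposition preserves the order of every pair except the one it swaps. -/
theorem swap_succ_lt_swap_succ {m : ℕ} {a b p q : Fin m} (hab : (a : ℕ) + 1 = b) (hpq : p < q)
    (hne : ¬(p = a ∧ q = b)) : Equiv.swap a b p < Equiv.swap a b q := by
  simp only [Equiv.swap_apply_def]
  rw [Fin.lt_def] at hpq
  simp only [Fin.ext_iff] at hne ⊢
  rw [Fin.lt_def]
  split_ifs <;> omega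

/-- The inversions of a permutation. -/
def inversions {m : ℕ} (σ : Equiv.Perm (Fin m)) : Finset (Fin m × Fin m) :=
  Finset.univ.filter fun p => p.1 < p.2 ∧ σ p.2 < σ p.1

theorem mem_inversions {m : ℕ} {σ : Equiv.Perm (Fin m)} {p : Fin m × Fin m} :
    p ∈ inversions σ ↔ p.1 < p.2 ∧ σ p.2 < σ p.1 := by
  simp [inversions]

theorem card_inversions_mul_swap {m : ℕ} (σ : Equiv.Perm (Fin m)) {a b : Fin m}
    (hab : (a : ℕ) + 1 = b) (h : σ b < σ a) :
    (inversions (σ * Equiv.swap a b)).card + 1 = (inversions σ).card := by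
  have hlt : a < b := by rw [Fin.lt_def]; omega
  have hmem : (a, b) ∈ inversions σ := mem_inversions.2 ⟨hlt, h⟩
  rw [← Finset.card_erase_add_one hmem, add_left_inj]
  refine Finset.card_nbij' (fun p => (Equiv.swap a b p.1, Equiv.swap a b p.2))
    (fun p => (Equiv.swap a b p.1, Equiv.swap a b p.2)) ?_ ?_ ?_ ?_
  · rintro ⟨p, q⟩ hp
    obtain ⟨h1, h2⟩ := mem_inversions.1 hp
    have hne : ¬(p = a ∧ q = b) := by
      rintro ⟨rfl, rfl⟩
      simp only [Equiv.Perm.mul_apply, Equiv.swap_apply_left, Equiv.swap_apply_right] at h2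
      exact lt_asymm h h2
    have h3 := swap_succ_lt_swap_succ hab h1 hne
    refine Finset.mem_erase.2 ⟨?_, mem_inversions.2 ⟨h3, h2⟩⟩
    intro he
    rw [Prod.mk.injEq, Equiv.swap_apply_eq_iff, Equiv.swap_apply_eq_iff,
      Equiv.swap_apply_left, Equiv.swap_apply_right] at he
    rw [he.1, he.2] at h1
    exact lt_asymm hlt h1
  · rintro ⟨p, q⟩ hp
    obtain ⟨h0, hp⟩ := Finset.mem_erase.1 hp
    obtain ⟨h1, h2⟩ := mem_inversions.1 hp
    have hne : ¬(p = a ∧ q = b) := fun h => h0 (by rw [h.1, h.2])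
    exact mem_inversions.2 ⟨swap_succ_lt_swap_succ hab h1 hne, by simpa using h2⟩
  · intro p _
    simp
  · intro p _
    simp

variable {n : ℕ}

theorem len_eq (σ : SgN n) : len n (mEta n) σ = ∑ k, (inversions (σ k)).card := rfl

/-- The transposition attached to a letter. -/
def letterPerm (s : SimpleDat n (mEta n)) : SgN n := simpleT n (mEta n) s.1 s.2.1 s.2.2

/-- The lower index moved by a letter. -/
def letterFst (s : SimpleDat n (mEta n)) : Fin (mEta n s.1) := ⟨s.2.1, Nat.lt_of_succ_lt s.2.2⟩

/-- The upper index moved by a letter. -/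
def letterSnd (s : SimpleDat n (mEta n)) : Fin (mEta n s.1) := ⟨s.2.1 + 1, s.2.2⟩

theorem letter_succ (s : SimpleDat n (mEta n)) : (letterFst s : ℕ) + 1 = letterSnd s := rfl

theorem letterPerm_apply_self (s : SimpleDat n (mEta n)) :
    letterPerm s s.1 = Equiv.swap (letterFst s) (letterSnd s) := by
  simp [letterPerm, simpleT, transpT, letterFst, letterSnd]

theorem letterPerm_apply_of_ne (s : SimpleDat n (mEta n)) {k : Fin n} (h : k ≠ s.1) :
    letterPerm s k = 1 := by
  simp [letterPerm, simpleT, transpT, Function.update_of_ne h]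

theorem letterPerm_mul_self (s : SimpleDat n (mEta n)) : letterPerm s * letterPerm s = 1 := by
  funext k
  by_cases h : k = s.1
  · subst h
    rw [Pi.mul_apply, letterPerm_apply_self, Equiv.swap_mul_self]
    rfl
  · rw [Pi.mul_apply, letterPerm_apply_of_ne s h]
    rfl

theorem len_mul_letterPerm_of_gt (σ : SgN n) (s : SimpleDat n (mEta n))
    (h : σ s.1 (letterSnd s) < σ s.1 (letterFst s)) :
    len n (mEta n) (σ * letterPerm s) + 1 = len n (mEta n) σ := by
  rw [len_eq, len_eq, ← Finset.add_sum_erase _ _ (Finset.mem_univ s.1),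
    ← Finset.add_sum_erase Finset.univ (fun k => (inversions (σ k)).card) (Finset.mem_univ s.1),
    ← card_inversions_mul_swap (σ s.1) (letter_succ s) h, Pi.mul_apply, letterPerm_apply_self]
  rw [add_right_comm]
  congr 1
  refine Finset.sum_congr rfl fun k hk => ?_
  rw [Pi.mul_apply, letterPerm_apply_of_ne s (Finset.ne_of_mem_erase hk), mul_one]

theorem len_mul_letterPerm_of_lt (σ : SgN n) (s : SimpleDat n (mEta n))
    (h : σ s.1 (letterFst s) < σ s.1 (letterSnd s)) :
    len n (mEta n) (σ * letterPerm s) = len n (mEta n) σ + 1 := by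
  have h' := len_mul_letterPerm_of_gt (σ * letterPerm s) s (by
    simpa [letterPerm_apply_self] using h)
  rw [mul_assoc, letterPerm_mul_self, mul_one] at h'
  exact h'.symm

theorem letterFst_ne_letterSnd (s : SimpleDat n (mEta n)) : letterFst s ≠ letterSnd s := by
  intro h
  have := letter_succ s
  rw [h] at this
  omega

theorem len_mul_letterPerm_le (σ : SgN n) (s : SimpleDat n (mEta n)) :
    len n (mEta n) (σ * letterPerm s) ≤ len n (mEta n) σ + 1 := by
  rcases lt_or_gt_of_ne ((σ s.1).injective.ne (letterFst_ne_letterSnd s)) with h | h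
  · exact (len_mul_letterPerm_of_lt σ s h).le
  · have := len_mul_letterPerm_of_gt σ s h
    omega

theorem len_one : len n (mEta n) 1 = 0 := by
  rw [len_eq]
  refine Finset.sum_eq_zero fun k _ => Finset.card_eq_zero.2 ?_
  refine Finset.eq_empty_of_forall_notMem fun p hp => ?_
  obtain ⟨h1, h2⟩ := mem_inversions.1 hp
  exact lt_asymm h1 h2

theorem wordPerm_nil : wordPerm n (mEta n) [] = 1 := rfl

theorem wordPerm_cons (s : SimpleDat n (mEta n)) (w : Word n (mEta n)) :
    wordPerm n (mEta n) (s :: w) = letterPerm s * wordPerm n (mEta n) w := by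
  simp [wordPerm, letterPerm]

theorem wordPerm_concat (w : Word n (mEta n)) (s : SimpleDat n (mEta n)) :
    wordPerm n (mEta n) (w ++ [s]) = wordPerm n (mEta n) w * letterPerm s := by
  simp [wordPerm, letterPerm]

theorem len_wordPerm_le (w : Word n (mEta n)) :
    len n (mEta n) (wordPerm n (mEta n) w) ≤ w.length := by
  induction w using List.reverseRecOn with
  | nil => rw [wordPerm_nil, len_one]; rfl
  | append_singleton w s ih =>
    rw [wordPerm_concat, List.length_append]
    exact (len_mul_letterPerm_le _ s).trans (Nat.succ_le_succ ih)

end Lengths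

section Blocks

variable {n : ℕ} {blk : IdxN n → ℕ}

/-- A letter acting inside a block. -/
def LetterBlk (blk : IdxN n → ℕ) (s : SimpleDat n (mEta n)) : Prop :=
  blk ⟨s.1, letterFst s⟩ = blk ⟨s.1, letterSnd s⟩

theorem mem_SgEta {σ : SgN n} :
    σ ∈ SgEta n blk ↔ ∀ (k : Fin n) (i : Fin (mEta n k)), blk ⟨k, σ k i⟩ = blk ⟨k, i⟩ :=
  ⟨fun h k i => h ⟨k, i⟩, fun h p => h p.1 p.2⟩

theorem letterPerm_mem {s : SimpleDat n (mEta n)} (hs : LetterBlk blk s) :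
    letterPerm s ∈ SgEta n blk := by
  rw [mem_SgEta]
  intro k i
  by_cases h : k = s.1
  · subst h
    rw [letterPerm_apply_self, Equiv.swap_apply_def]
    split_ifs with h1 h2
    · rw [h1]; exact hs.symm
    · rw [h2]; exact hs
    · rfl
  · rw [letterPerm_apply_of_ne s h]
    rfl

theorem wordBlk_cons {s : SimpleDat n (mEta n)} {w : Word n (mEta n)} :
    WordBlk n blk (s :: w) ↔ LetterBlk blk s ∧ WordBlk n blk w :=
  List.forall_mem_cons

theorem wordBlk_concat {s : SimpleDat n (mEta n)} {w : Word n (mEta n)} :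
    WordBlk n blk (w ++ [s]) ↔ WordBlk n blk w ∧ LetterBlk blk s := by
  unfold WordBlk
  rw [List.forall_mem_append, List.forall_mem_singleton]
  rfl

theorem wordPerm_mem {w : Word n (mEta n)} (hw : WordBlk n blk w) :
    wordPerm n (mEta n) w ∈ SgEta n blk := by
  induction w with
  | nil => exact one_mem _
  | cons s w ih =>
    rw [wordBlk_cons] at hw
    rw [wordPerm_cons]
    exact mul_mem (letterPerm_mem hw.1) (ih hw.2)

/-- Rows are cut by `blk` into intervals. -/
def BlkMono (blk : IdxN n → ℕ) : Prop :=
  ∀ k : Fin n, Monotone fun i : Fin ((k : ℕ) + 1) => blk ⟨k, i⟩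

/-- A row function that is not monotone on a block has an adjacent descent there. -/
theorem exists_letter_of_lt (hm : BlkMono blk) {α : Type*} [LinearOrder α] (k : Fin n)
    (f : Fin (mEta n k) → α) {i j : Fin (mEta n k)} (hij : i < j)
    (hb : blk ⟨k, i⟩ = blk ⟨k, j⟩) (hf : f j < f i) :
    ∃ s : SimpleDat n (mEta n), ∃ h : s.1 = k, LetterBlk blk s ∧
      f (h ▸ letterSnd s) < f (h ▸ letterFst s) := by
  by_contra hcon
  push Not at hcon
  have key : ∀ d : ℕ, ∀ hd : (i : ℕ) + d ≤ j,
      f i ≤ f ⟨i + d, lt_of_le_of_lt hd j.2⟩ := by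
    intro d
    induction d with
    | zero => intro _; exact le_rfl
    | succ d ih =>
      intro hd
      refine (ih (by omega)).trans ?_
      have h2 : (i : ℕ) + d + 1 < mEta n k := lt_of_le_of_lt hd j.2
      refine hcon ⟨k, ⟨i + d, h2⟩⟩ rfl ?_
      have e1 := hm k (show i ≤ ⟨i + d, by omega⟩ by rw [Fin.le_def]; simp)
      have e2 := hm k (show (⟨i + d, by omega⟩ : Fin (mEta n k)) ≤ ⟨i + d + 1, h2⟩ by
        rw [Fin.le_def]; simp)
      have e3 := hm k (show (⟨i + d + 1, h2⟩ : Fin (mEta n k)) ≤ j by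
        rw [Fin.le_def]; change (i : ℕ) + d + 1 ≤ j; omega)
      exact le_antisymm e2 (e3.trans (hb.symm.le.trans e1))
  have h := key (j - i) (by have := Fin.lt_def.1 hij; omega)
  have hj : (⟨i + (j - i), by have := Fin.lt_def.1 hij; omega⟩ : Fin (mEta n k)) = j := by
    ext; have := Fin.lt_def.1 hij; simp; omega
  rw [hj] at h
  exact absurd hf (not_lt.2 h)

theorem blk_eq_of_inversion (hm : BlkMono blk) {σ : SgN n} (hσ : σ ∈ SgEta n blk) {k : Fin n}
    {i j : Fin (mEta n k)} (hij : i < j) (h : σ k j < σ k i) : blk ⟨k, i⟩ = blk ⟨k, j⟩ := by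
  rw [mem_SgEta] at hσ
  refine le_antisymm (hm k hij.le) ?_
  rw [← hσ k i, ← hσ k j]
  exact hm k h.le

theorem exists_descent (hm : BlkMono blk) {σ : SgN n} (hσ : σ ∈ SgEta n blk)
    (h : len n (mEta n) σ ≠ 0) :
    ∃ s : SimpleDat n (mEta n), LetterBlk blk s ∧ σ s.1 (letterSnd s) < σ s.1 (letterFst s) := by
  rw [len_eq] at h
  obtain ⟨k, -, hk⟩ := Finset.exists_ne_zero_of_sum_ne_zero h
  obtain ⟨⟨i, j⟩, hp⟩ := Finset.card_ne_zero.1 hk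
  obtain ⟨h1, h2⟩ := mem_inversions.1 hp
  obtain ⟨s, rfl, hs, hlt⟩ :=
    exists_letter_of_lt hm k (σ k) h1 (blk_eq_of_inversion hm hσ h1 h2) h2
  exact ⟨s, hs, hlt⟩

theorem eq_one_of_len_eq_zero {σ : SgN n} (h : len n (mEta n) σ = 0) : σ = 1 := by
  rw [len_eq, Finset.sum_eq_zero_iff] at h
  funext k
  have hk := Finset.card_eq_zero.1 (h k (Finset.mem_univ k))
  have hmono : StrictMono (σ k) := by
    intro i j hij
    by_contra hlt
    have : (i, j) ∈ inversions (σ k) := mem_inversions.2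
      ⟨hij, lt_of_le_of_ne (not_lt.1 hlt) ((σ k).injective.ne hij.ne')⟩
    rw [hk] at this
    exact Finset.notMem_empty _ this
  have : hmono.orderIsoOfSurjective _ (σ k).surjective = OrderIso.refl _ := Subsingleton.elim _ _
  ext i
  have h2 := congrArg (fun e : Fin (mEta n k) ≃o Fin (mEta n k) => e i) this
  exact congrArg Fin.val h2

theorem exists_reduced (hm : BlkMono blk) {σ : SgN n} (hσ : σ ∈ SgEta n blk) :
    ∃ w : Word n (mEta n), IsRedB n blk σ w := by
  induction hl : len n (mEta n) σ generalizing σ with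
  | zero =>
    rw [eq_one_of_len_eq_zero hl]
    exact ⟨[], ⟨rfl, len_one.symm⟩, by intro s hs; simp at hs⟩
  | succ m ih =>
    obtain ⟨s, hs, hlt⟩ := exists_descent hm hσ (by omega)
    have hlen := len_mul_letterPerm_of_gt σ s hlt
    obtain ⟨w, ⟨hw1, hw2⟩, hw3⟩ := ih (mul_mem hσ (letterPerm_mem hs)) (by omega)
    refine ⟨w ++ [s], ⟨?_, ?_⟩, wordBlk_concat.2 ⟨hw3, hs⟩⟩
    · rw [wordPerm_concat, hw1, mul_assoc, letterPerm_mul_self, mul_one]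
    · rw [List.length_append, hw2, ← hlen]; rfl

/-- A property of block-preserving permutations holds as soon as it holds for the identity and is
stable under left multiplication by letters. -/
theorem SgEta_induction (hm : BlkMono blk) {P : SgN n → Prop} (one : P 1)
    (mul : ∀ s : SimpleDat n (mEta n), LetterBlk blk s → ∀ σ ∈ SgEta n blk, P σ →
      P (letterPerm s * σ)) {σ : SgN n} (hσ : σ ∈ SgEta n blk) : P σ := by
  obtain ⟨w, ⟨rfl, -⟩, hw⟩ := exists_reduced hm hσ
  clear hσ
  induction w with
  | nil => exact one
  | cons s w ih =>
    rw [wordBlk_cons] at hw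
    rw [wordPerm_cons]
    exact mul s hw.1 _ (wordPerm_mem hw.2) (ih hw.2)

/-- The pairs of positions in a common block. -/
def blkPairs (blk : IdxN n → ℕ) (k : Fin n) : Finset (Fin (mEta n k) × Fin (mEta n k)) :=
  Finset.univ.filter fun p => p.1 < p.2 ∧ blk ⟨k, p.1⟩ = blk ⟨k, p.2⟩

theorem mem_blkPairs {k : Fin n} {p : Fin (mEta n k) × Fin (mEta n k)} :
    p ∈ blkPairs blk k ↔ p.1 < p.2 ∧ blk ⟨k, p.1⟩ = blk ⟨k, p.2⟩ := by
  simp [blkPairs]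

/-- The length of the longest element of `SgEta n blk`. -/
def maxLen (blk : IdxN n → ℕ) : ℕ := ∑ k, (blkPairs blk k).card

theorem len_le_maxLen (hm : BlkMono blk) {σ : SgN n} (hσ : σ ∈ SgEta n blk) :
    len n (mEta n) σ ≤ maxLen blk := by
  rw [len_eq]
  refine Finset.sum_le_sum fun k _ => Finset.card_le_card fun p hp => ?_
  obtain ⟨h1, h2⟩ := mem_inversions.1 hp
  exact mem_blkPairs.2 ⟨h1, blk_eq_of_inversion hm hσ h1 h2⟩

theorem exists_len_eq_maxLen (hm : BlkMono blk) :
    ∃ σ ∈ SgEta n blk, len n (mEta n) σ = maxLen blk := by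
  classical
  obtain ⟨σ, hσ, hmax⟩ := Finset.exists_max_image
    (Finset.univ.filter fun σ : SgN n => σ ∈ SgEta n blk) (len n (mEta n))
    ⟨1, by simp⟩
  simp only [Finset.mem_filter, Finset.mem_univ, true_and] at hσ hmax
  refine ⟨σ, hσ, le_antisymm (len_le_maxLen hm hσ) ?_⟩
  rw [len_eq]
  refine Finset.sum_le_sum fun k _ => Finset.card_le_card ?_
  rintro ⟨i, j⟩ hp
  obtain ⟨h1, h2⟩ := mem_blkPairs.1 hp
  refine mem_inversions.2 ⟨h1, ?_⟩
  by_contra hlt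
  have hlt : σ k i < σ k j := lt_of_le_of_ne (not_lt.1 hlt) ((σ k).injective.ne h1.ne)
  obtain ⟨s, rfl, hs, h3⟩ :=
    exists_letter_of_lt hm k (fun i => OrderDual.toDual (σ k i)) h1 h2 hlt
  have h4 := len_mul_letterPerm_of_lt σ s h3
  have h5 := hmax _ (mul_mem hσ (letterPerm_mem hs))
  omega

end Blocks

section DividedDifferences

variable {n : ℕ}

/-- The difference of the two variables exchanged by a letter. -/
def root (s : SimpleDat n (mEta n)) : PolN n :=
  MvPolynomial.X ⟨s.1, letterFst s⟩ - MvPolynomial.X ⟨s.1, letterSnd s⟩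

/-- The embedding of polynomials in rational functions. -/
abbrev toK : PolN n →+* KK n := algebraMap (PolN n) (KK n)

theorem toK_injective : Function.Injective (toK : PolN n → KK n) :=
  IsFractionRing.injective (PolN n) (KK n)

theorem toK_ne_zero {p : PolN n} (hp : p ≠ 0) : toK p ≠ 0 :=
  (map_ne_zero_iff toK toK_injective).2 hp

theorem X_sub_X_ne_zero {p q : IdxN n} (h : p ≠ q) :
    (MvPolynomial.X p - MvPolynomial.X q : PolN n) ≠ 0 :=
  sub_ne_zero.2 fun he => h (MvPolynomial.X_injective he)

theorem KK_inv_neg (a : KK n) : (-a)⁻¹ = -a⁻¹ := inv_neg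

theorem root_ne_zero (s : SimpleDat n (mEta n)) : root s ≠ 0 :=
  X_sub_X_ne_zero fun h => letterFst_ne_letterSnd s (eq_of_heq (Sigma.mk.inj h).2)

theorem ddV_letter (s : SimpleDat n (mEta n)) (x : VK n) :
    ddV n s.1 s.2.1 s.2.2 x = (toK (root s))⁻¹ • (x - sact n (letterPerm s) x) := by
  rw [root, map_sub]
  rfl

theorem root_smul_ddV (s : SimpleDat n (mEta n)) (x : VK n) :
    toK (root s) • ddV n s.1 s.2.1 s.2.2 x = x - sact n (letterPerm s) x := by
  rw [ddV_letter, smul_smul, mul_inv_cancel₀ (toK_ne_zero (root_ne_zero s)), one_smul]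

theorem permIdx_letter_fst (s : SimpleDat n (mEta n)) :
    permIdx n (mEta n) (letterPerm s) ⟨s.1, letterFst s⟩ = ⟨s.1, letterSnd s⟩ := by
  change (⟨s.1, letterPerm s s.1 (letterFst s)⟩ : IdxN n) = _
  rw [letterPerm_apply_self, Equiv.swap_apply_left]

theorem permIdx_letter_snd (s : SimpleDat n (mEta n)) :
    permIdx n (mEta n) (letterPerm s) ⟨s.1, letterSnd s⟩ = ⟨s.1, letterFst s⟩ := by
  change (⟨s.1, letterPerm s s.1 (letterSnd s)⟩ : IdxN n) = _
  rw [letterPerm_apply_self, Equiv.swap_apply_right]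

theorem actP_root (s : SimpleDat n (mEta n)) :
    actP n (mEta n) (letterPerm s) (root s) = -root s := by
  rw [root, map_sub, actP_X, actP_X, permIdx_letter_fst, permIdx_letter_snd, neg_sub]

theorem root_dvd_sub_act (s : SimpleDat n (mEta n)) (p : PolN n) :
    root s ∣ p - actP n (mEta n) (letterPerm s) p := by
  induction p using MvPolynomial.induction_on with
  | C a => rw [actP_C, sub_self]; exact dvd_zero _
  | add p q hp hq =>
    rw [map_add, add_sub_add_comm]
    exact dvd_add hp hq
  | mul_X p i hp =>
    have hX : root s ∣ MvPolynomial.X i - MvPolynomial.X (permIdx n (mEta n) (letterPerm s) i) := by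
      obtain ⟨k, i⟩ := i
      by_cases h : k = s.1
      · subst h
        by_cases h1 : i = letterFst s
        · rw [h1, permIdx_letter_fst]; exact dvd_rfl
        by_cases h2 : i = letterSnd s
        · rw [h2, permIdx_letter_snd, ← neg_sub]; exact (dvd_neg.2 dvd_rfl)
        change root s ∣ _ - MvPolynomial.X (⟨s.1, letterPerm s s.1 i⟩ : IdxN n)
        rw [letterPerm_apply_self, Equiv.swap_apply_of_ne_of_ne h1 h2, sub_self]
        exact dvd_zero _
      · change root s ∣ _ - MvPolynomial.X (⟨k, letterPerm s k i⟩ : IdxN n)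
        rw [letterPerm_apply_of_ne s h, Equiv.Perm.one_apply, sub_self]
        exact dvd_zero _
    rw [map_mul, actP_X]
    have e : p * MvPolynomial.X i - actP n (mEta n) (letterPerm s) p *
        MvPolynomial.X (permIdx n (mEta n) (letterPerm s) i) =
        (p - actP n (mEta n) (letterPerm s) p) * MvPolynomial.X i +
        actP n (mEta n) (letterPerm s) p *
          (MvPolynomial.X i - MvPolynomial.X (permIdx n (mEta n) (letterPerm s) i)) := by ring
    rw [e]
    exact dvd_add (hp.mul_right _) (hX.mul_left _)

/-- The divided difference of a polynomial along a letter. -/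
def ddP (s : SimpleDat n (mEta n)) (p : PolN n) : PolN n := (root_dvd_sub_act s p).choose

theorem root_mul_ddP (s : SimpleDat n (mEta n)) (p : PolN n) :
    root s * ddP s p = p - actP n (mEta n) (letterPerm s) p :=
  (root_dvd_sub_act s p).choose_spec.symm

theorem totalDegree_actP_le (σ : SgN n) (p : PolN n) :
    (actP n (mEta n) σ p).totalDegree ≤ p.totalDegree :=
  MvPolynomial.totalDegree_rename_le _ p

theorem totalDegree_root (s : SimpleDat n (mEta n)) : 1 ≤ (root s).totalDegree := by
  by_contra h
  have h0 : (root s).totalDegree = 0 := by omega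
  rw [MvPolynomial.totalDegree_eq_zero_iff_eq_C] at h0
  have h1 := actP_root s
  rw [h0, actP_C] at h1
  rw [← h0] at h1
  exact root_ne_zero s (self_eq_neg.1 h1)

theorem totalDegree_ddP_le (s : SimpleDat n (mEta n)) (p : PolN n) :
    (ddP s p).totalDegree ≤ p.totalDegree - 1 := by
  by_cases h : ddP s p = 0
  · rw [h]; simp
  have h1 := MvPolynomial.totalDegree_mul_of_isDomain (root_ne_zero s) h
  rw [root_mul_ddP] at h1
  have h2 := MvPolynomial.totalDegree_sub p (actP n (mEta n) (letterPerm s) p)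
  have h3 := totalDegree_actP_le (letterPerm s) p
  have h4 := totalDegree_root s
  rw [max_eq_left h3] at h2
  omega

/-- The iterated divided difference of a polynomial along a word, first letter first. -/
def ddPWord (w : Word n (mEta n)) (p : PolN n) : PolN n := w.foldl (fun q s => ddP s q) p

theorem totalDegree_ddPWord_le (w : Word n (mEta n)) (p : PolN n) :
    (ddPWord w p).totalDegree ≤ p.totalDegree - w.length := by
  induction w generalizing p with
  | nil => exact le_rfl
  | cons s w ih =>
    refine (ih (ddP s p)).trans ?_
    have := totalDegree_ddP_le s p
    rw [List.length_cons]
    omega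

theorem ddV_add (s : SimpleDat n (mEta n)) (x y : VK n) :
    ddV n s.1 s.2.1 s.2.2 (x + y) = ddV n s.1 s.2.1 s.2.2 x + ddV n s.1 s.2.1 s.2.2 y := by
  rw [ddV_letter, ddV_letter, ddV_letter, sact_add, ← smul_add, add_sub_add_comm]

theorem ddV_zero (s : SimpleDat n (mEta n)) : ddV n s.1 s.2.1 s.2.2 (0 : VK n) = 0 := by
  rw [ddV_letter, sact_zero, sub_zero, smul_zero]

theorem sact_ddV (s : SimpleDat n (mEta n)) (x : VK n) :
    sact n (letterPerm s) (ddV n s.1 s.2.1 s.2.2 x) = ddV n s.1 s.2.1 s.2.2 x := by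
  rw [ddV_letter, sact_smul, map_inv₀, actF_algebraMap, actP_root, sact_sub, ← sact_mul,
    letterPerm_mul_self, sact_one, map_neg, KK_inv_neg, neg_smul, ← smul_neg, neg_sub]

theorem ddV_ddV (s : SimpleDat n (mEta n)) (x : VK n) :
    ddV n s.1 s.2.1 s.2.2 (ddV n s.1 s.2.1 s.2.2 x) = 0 := by
  rw [ddV_letter s (ddV n s.1 s.2.1 s.2.2 x), sact_ddV, sub_self, smul_zero]

theorem sact_of_ddV_eq_zero {s : SimpleDat n (mEta n)} {x : VK n}
    (h : ddV n s.1 s.2.1 s.2.2 x = 0) : sact n (letterPerm s) x = x := by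
  have h1 := root_smul_ddV s x
  rw [h, smul_zero] at h1
  exact (sub_eq_zero.1 h1.symm).symm

/-- The Leibniz rule. -/
theorem ddV_smul (s : SimpleDat n (mEta n)) (p : PolN n) (x : VK n) :
    ddV n s.1 s.2.1 s.2.2 (toK p • x) =
      toK (actP n (mEta n) (letterPerm s) p) • ddV n s.1 s.2.1 s.2.2 x + toK (ddP s p) • x := by
  have hr := toK_ne_zero (root_ne_zero s)
  have h : toK (ddP s p) = (toK (root s))⁻¹ * (toK p - toK (actP n (mEta n) (letterPerm s) p)) := by
    rw [← map_sub, ← root_mul_ddP, map_mul, inv_mul_cancel_left₀ hr]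
  rw [ddV_letter, ddV_letter, sact_smul, actF_algebraMap, h, smul_comm (toK _) (_⁻¹ : KK n),
    mul_smul, ← smul_add]
  congr 1
  rw [smul_sub, sub_smul]
  abel

theorem ddWordV_nil (x : VK n) : ddWordV n [] x = x := rfl

theorem ddWordV_cons (s : SimpleDat n (mEta n)) (w : Word n (mEta n)) (x : VK n) :
    ddWordV n (s :: w) x = ddV n s.1 s.2.1 s.2.2 (ddWordV n w x) := rfl

theorem ddWordV_append (w w' : Word n (mEta n)) (x : VK n) :
    ddWordV n (w ++ w') x = ddWordV n w (ddWordV n w' x) := by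
  simp [ddWordV]

theorem ddWordV_zero (w : Word n (mEta n)) : ddWordV n w (0 : VK n) = 0 := by
  induction w with
  | nil => rfl
  | cons s w ih => rw [ddWordV_cons, ih, ddV_zero]

end DividedDifferences

section Symmetrization

variable {n : ℕ} (blk : IdxN n → ℕ)

open Classical in
/-- The elements of `SgEta n blk` as a finite set. -/
def SgFin : Finset (SgN n) := Finset.univ.filter fun σ => σ ∈ SgEta n blk

variable {blk}

theorem mem_SgFin {σ : SgN n} : σ ∈ SgFin blk ↔ σ ∈ SgEta n blk := by
  simp [SgFin]

theorem sum_SgFin_mul_left {M : Type*} [AddCommMonoid M] {τ : SgN n} (hτ : τ ∈ SgEta n blk)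
    (f : SgN n → M) : ∑ σ ∈ SgFin blk, f (τ * σ) = ∑ σ ∈ SgFin blk, f σ := by
  refine Finset.sum_nbij' (fun σ => τ * σ) (fun σ => τ⁻¹ * σ) ?_ ?_ ?_ ?_ ?_
  · intro σ hσ; exact mem_SgFin.2 (mul_mem hτ (mem_SgFin.1 hσ))
  · intro σ hσ; exact mem_SgFin.2 (mul_mem (inv_mem hτ) (mem_SgFin.1 hσ))
  · intro σ _; simp
  · intro σ _; simp
  · intro σ _; rfl

theorem sum_SgFin_mul_right {M : Type*} [AddCommMonoid M] {τ : SgN n} (hτ : τ ∈ SgEta n blk)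
    (f : SgN n → M) : ∑ σ ∈ SgFin blk, f (σ * τ) = ∑ σ ∈ SgFin blk, f σ := by
  refine Finset.sum_nbij' (fun σ => σ * τ) (fun σ => σ * τ⁻¹) ?_ ?_ ?_ ?_ ?_
  · intro σ hσ; exact mem_SgFin.2 (mul_mem (mem_SgFin.1 hσ) hτ)
  · intro σ hσ; exact mem_SgFin.2 (mul_mem (mem_SgFin.1 hσ) (inv_mem hτ))
  · intro σ _; simp
  · intro σ _; simp
  · intro σ _; rfl

variable (blk)

/-- The unnormalized symmetrization. -/
def symSum : VK n →+ VK n := ∑ σ ∈ SgFin blk, sactHom σ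

theorem symSum_apply (x : VK n) : symSum blk x = ∑ σ ∈ SgFin blk, sact n σ x := by
  rw [symSum, AddMonoidHom.finsetSum_apply]
  rfl

theorem etaFactB_eq : etaFactB n blk = (SgFin blk).card := by
  rw [etaFactB, ← Nat.card_eq_finsetCard]
  exact Nat.card_congr (Equiv.subtypeEquivRight fun σ => mem_SgFin.symm)

theorem etaFactB_ne_zero : (etaFactB n blk : ℂ) ≠ 0 := by
  rw [Nat.cast_ne_zero, etaFactB]
  exact Nat.card_pos.ne'

theorem symV_eq (x : VK n) :
    symV n blk x = (algebraMap ℂ (KK n) (etaFactB n blk : ℂ)⁻¹) • symSum blk x := by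
  rw [symSum_apply, map_inv₀, map_natCast, symV]
  congr 1
  exact (Finset.sum_subtype (SgFin blk) (fun σ => mem_SgFin) (fun σ => sact n σ x)).symm

variable {blk}

theorem symSum_sact {τ : SgN n} (hτ : τ ∈ SgEta n blk) (x : VK n) :
    symSum blk (sact n τ x) = symSum blk x := by
  simp only [symSum_apply, ← sact_mul]
  exact sum_SgFin_mul_right hτ fun σ => sact n σ x

theorem symSum_smul {f : KK n} (hf : ∀ σ ∈ SgEta n blk, actF n (mEta n) σ f = f) (x : VK n) :
    symSum blk (f • x) = f • symSum blk x := by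
  simp only [symSum_apply, sact_smul, Finset.smul_sum]
  exact Finset.sum_congr rfl fun σ hσ => by rw [hf σ (mem_SgFin.1 hσ)]

theorem symSum_of_invariant {x : VK n} (hx : ∀ σ ∈ SgEta n blk, sact n σ x = x) :
    symSum blk x = (etaFactB n blk : KK n) • x := by
  rw [symSum_apply, Finset.sum_congr rfl fun σ hσ => hx σ (mem_SgFin.1 hσ), Finset.sum_const,
    etaFactB_eq, Nat.cast_smul_eq_nsmul]

end Symmetrization

section Vandermonde

variable {n : ℕ}

/-- The product of the differences of variables over a family of pairs of positions. -/
def pairProd (S : ∀ k : Fin n, Finset (Fin (mEta n k) × Fin (mEta n k))) : PolN n :=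
  ∏ k, ∏ p ∈ S k, (MvPolynomial.X ⟨k, p.1⟩ - MvPolynomial.X ⟨k, p.2⟩)

theorem actP_pairProd (σ : SgN n)
    (S : ∀ k : Fin n, Finset (Fin (mEta n k) × Fin (mEta n k))) :
    actP n (mEta n) σ (pairProd S) =
      ∏ k, ∏ p ∈ S k, (MvPolynomial.X ⟨k, σ k p.1⟩ - MvPolynomial.X ⟨k, σ k p.2⟩) := by
  simp only [pairProd, map_prod, map_sub, actP_X]
  rfl

theorem pairProd_ne_zero {S : ∀ k : Fin n, Finset (Fin (mEta n k) × Fin (mEta n k))}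
    (hS : ∀ k, ∀ p ∈ S k, p.1 ≠ p.2) : pairProd S ≠ 0 :=
  Finset.prod_ne_zero_iff.2 fun k _ => Finset.prod_ne_zero_iff.2 fun p hp =>
    X_sub_X_ne_zero fun h => hS k p hp (eq_of_heq (Sigma.mk.inj h).2)

theorem totalDegree_pairProd_le (S : ∀ k : Fin n, Finset (Fin (mEta n k) × Fin (mEta n k))) :
    (pairProd S).totalDegree ≤ ∑ k, (S k).card := by
  refine (MvPolynomial.totalDegree_finsetProd _ _).trans (Finset.sum_le_sum fun k _ => ?_)
  refine (MvPolynomial.totalDegree_finsetProd _ _).trans ?_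
  refine (Finset.sum_le_card_nsmul _ _ 1 fun p _ => ?_).trans (by simp)
  refine (MvPolynomial.totalDegree_sub _ _).trans ?_
  simp

variable (blk : IdxN n → ℕ)

/-- The product of the differences of variables in a common block. -/
def vdm : PolN n := pairProd (blkPairs blk)

variable {blk}

theorem vdm_ne_zero : vdm blk ≠ 0 :=
  pairProd_ne_zero fun _ _ hp => (mem_blkPairs.1 hp).1.ne

theorem actP_letterPerm_vdm {s : SimpleDat n (mEta n)} (hs : LetterBlk blk s) :
    actP n (mEta n) (letterPerm s) (vdm blk) = -vdm blk := by
  have hmem : (letterFst s, letterSnd s) ∈ blkPairs blk s.1 :=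
    mem_blkPairs.2 ⟨by rw [Fin.lt_def, ← letter_succ]; exact Nat.lt_succ_self _, hs⟩
  rw [vdm, actP_pairProd, pairProd, ← Finset.mul_prod_erase Finset.univ _ (Finset.mem_univ s.1),
    ← Finset.mul_prod_erase Finset.univ (fun k => ∏ p ∈ blkPairs blk k,
      (MvPolynomial.X (⟨k, p.1⟩ : IdxN n) - MvPolynomial.X (⟨k, p.2⟩ : IdxN n)))
      (Finset.mem_univ s.1), ← neg_mul]
  congr 1
  · rw [← Finset.mul_prod_erase _ _ hmem, ← Finset.mul_prod_erase (blkPairs blk s.1)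
      (fun p => (MvPolynomial.X (⟨s.1, p.1⟩ : IdxN n) - MvPolynomial.X (⟨s.1, p.2⟩ : IdxN n)))
      hmem, ← neg_mul]
    congr 1
    · rw [letterPerm_apply_self, Equiv.swap_apply_left, Equiv.swap_apply_right, neg_sub]
    · have hmaps : ∀ p ∈ (blkPairs blk s.1).erase (letterFst s, letterSnd s),
          (letterPerm s s.1 p.1, letterPerm s s.1 p.2) ∈
            (blkPairs blk s.1).erase (letterFst s, letterSnd s) := by
        rintro ⟨i, j⟩ hp
        obtain ⟨h0, h1⟩ := Finset.mem_erase.1 hp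
        obtain ⟨h1, h2⟩ := mem_blkPairs.1 h1
        have h3 : letterPerm s s.1 i < letterPerm s s.1 j := by
          rw [letterPerm_apply_self]
          exact swap_succ_lt_swap_succ (letter_succ s) h1 fun h => h0 (Prod.ext h.1 h.2)
        have h4 := mem_SgEta.1 (letterPerm_mem hs) s.1
        refine Finset.mem_erase.2 ⟨?_, mem_blkPairs.2 ⟨h3, ?_⟩⟩
        · intro he
          rw [Prod.mk.injEq, letterPerm_apply_self, Equiv.swap_apply_eq_iff,
            Equiv.swap_apply_eq_iff, Equiv.swap_apply_left, Equiv.swap_apply_right] at he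
          have h5 := letter_succ s
          rw [he.1, he.2, Fin.lt_def] at h1
          omega
        · exact (h4 i).trans (h2.trans (h4 j).symm)
      refine Finset.prod_nbij' (fun p => (letterPerm s s.1 p.1, letterPerm s s.1 p.2))
        (fun p => (letterPerm s s.1 p.1, letterPerm s s.1 p.2)) hmaps hmaps ?_ ?_ ?_
      · intro p _; simp [letterPerm_apply_self]
      · intro p _; simp [letterPerm_apply_self]
      · intro p _; rfl
  · refine Finset.prod_congr rfl fun k hk => ?_
    rw [letterPerm_apply_of_ne s (Finset.ne_of_mem_erase hk)]
    rfl

theorem actP_vdm (hm : BlkMono blk) {σ : SgN n} (hσ : σ ∈ SgEta n blk) :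
    actP n (mEta n) σ (vdm blk) = vdm blk ∨ actP n (mEta n) σ (vdm blk) = -vdm blk := by
  refine SgEta_induction (P := fun τ => actP n (mEta n) τ (vdm blk) = vdm blk ∨
    actP n (mEta n) τ (vdm blk) = -vdm blk) hm (Or.inl (actP_one _)) (fun s hs σ _ ih => ?_) hσ
  rw [actP_mul]
  rcases ih with h | h
  · rw [h, actP_letterPerm_vdm hs]; exact Or.inr rfl
  · rw [h, map_neg, actP_letterPerm_vdm hs, neg_neg]; exact Or.inl rfl

/-- Divided differences are self-adjoint for the pairing defined by symmetrization. -/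
theorem symSum_div_smul_ddV {s : SimpleDat n (mEta n)} (hs : LetterBlk blk s) (h : PolN n)
    (x : VK n) :
    symSum blk ((toK h / toK (vdm blk)) • ddV n s.1 s.2.1 s.2.2 x) =
      symSum blk ((toK (ddP s h) / toK (vdm blk)) • x) := by
  have hr := toK_ne_zero (root_ne_zero s)
  have hv := toK_ne_zero (vdm_ne_zero (blk := blk))
  set g : KK n := toK h / toK (vdm blk) * (toK (root s))⁻¹ with hg
  have hsg : actF n (mEta n) (letterPerm s) g =
      toK (actP n (mEta n) (letterPerm s) h) / toK (vdm blk) * (toK (root s))⁻¹ := by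
    rw [hg, map_mul, map_div₀, map_inv₀, actF_algebraMap, actF_algebraMap, actF_algebraMap,
      actP_root, actP_letterPerm_vdm hs, map_neg, map_neg]
    field_simp
  have h1 : (toK h / toK (vdm blk)) • ddV n s.1 s.2.1 s.2.2 x =
      g • x - sact n (letterPerm s) (actF n (mEta n) (letterPerm s) g • x) := by
    rw [ddV_letter, smul_smul, smul_sub, sact_smul, ← actF_mul, letterPerm_mul_self, actF_one]
  have h2 : toK (ddP s h) / toK (vdm blk) = g - actF n (mEta n) (letterPerm s) g := by
    have h3 := congrArg toK (root_mul_ddP s h)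
    rw [map_mul, map_sub] at h3
    rw [hsg, hg]
    field_simp
    exact (mul_comm _ _).trans h3
  rw [h1, map_sub, symSum_sact (letterPerm_mem hs), ← map_sub, ← sub_smul, h2]

theorem symSum_div_smul_ddWordV {w : Word n (mEta n)} (hw : WordBlk n blk w) (h : PolN n)
    (x : VK n) :
    symSum blk ((toK h / toK (vdm blk)) • ddWordV n w x) =
      symSum blk ((toK (ddPWord w h) / toK (vdm blk)) • x) := by
  induction w generalizing h with
  | nil => rfl
  | cons s w ih =>
    rw [wordBlk_cons] at hw
    rw [ddWordV_cons, symSum_div_smul_ddV hw.1, ih hw.2]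
    rfl

theorem symSum_ddWordV {w : Word n (mEta n)} (hw : WordBlk n blk w) (x : VK n) :
    symSum blk (ddWordV n w x) =
      symSum blk ((toK (ddPWord w (vdm blk)) / toK (vdm blk)) • x) := by
  rw [← symSum_div_smul_ddWordV hw, div_self (toK_ne_zero vdm_ne_zero), one_smul]

end Vandermonde

section Words

variable {n : ℕ} {blk : IdxN n → ℕ}

/-- Reduced words of the same block-preserving permutation define the same operator on `VK`. -/
def WordIndep (blk : IdxN n → ℕ) : Prop :=
  ∀ σ ∈ SgEta n blk, ∀ w w' : Word n (mEta n), IsRedB n blk σ w → IsRedB n blk σ w' →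
    ∀ x : VK n, ddWordV n w x = ddWordV n w' x

theorem ddWordV_eq_zero_or_reduced (hm : BlkMono blk) (hi : WordIndep blk)
    {w : Word n (mEta n)} (hw : WordBlk n blk w) :
    (∀ x : VK n, ddWordV n w x = 0) ∨ IsRedB n blk (wordPerm n (mEta n) w) w := by
  induction w using List.reverseRecOn with
  | nil => exact Or.inr ⟨⟨rfl, len_one.symm⟩, hw⟩
  | append_singleton w s ih =>
    have hws := wordBlk_concat.1 hw
    rcases ih hws.1 with h0 | hred
    · exact Or.inl fun x => by rw [ddWordV_append, h0]
    rcases lt_or_gt_of_ne ((wordPerm n (mEta n) w s.1).injective.ne (letterFst_ne_letterSnd s))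
      with h | h
    · refine Or.inr ⟨⟨rfl, ?_⟩, hw⟩
      rw [wordPerm_concat, len_mul_letterPerm_of_lt _ s h, List.length_append, hred.1.2]
      rfl
    · left
      intro x
      have hlen := len_mul_letterPerm_of_gt _ s h
      have hmem := wordPerm_mem hws.1
      obtain ⟨u, ⟨hu1, hu2⟩, hu3⟩ := exists_reduced hm (mul_mem hmem (letterPerm_mem hws.2))
      have hus : IsRedB n blk (wordPerm n (mEta n) w) (u ++ [s]) := by
        refine ⟨⟨?_, ?_⟩, wordBlk_concat.2 ⟨hu3, hws.2⟩⟩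
        · rw [wordPerm_concat, hu1, mul_assoc, letterPerm_mul_self, mul_one]
        · rw [List.length_append, hu2, ← hlen]
          rfl
      rw [ddWordV_append, hi _ hmem _ _ hred hus, ddWordV_append]
      change ddWordV n u (ddV n s.1 s.2.1 s.2.2 (ddV n s.1 s.2.1 s.2.2 x)) = 0
      rw [ddV_ddV, ddWordV_zero]

theorem ddWordV_eq_zero_of_maxLen_lt (hm : BlkMono blk) (hi : WordIndep blk)
    {w : Word n (mEta n)} (hw : WordBlk n blk w) (hlen : maxLen blk < w.length) (x : VK n) :
    ddWordV n w x = 0 := by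
  rcases ddWordV_eq_zero_or_reduced hm hi hw with h | h
  · exact h x
  · have h1 := len_le_maxLen hm (wordPerm_mem hw)
    rw [← h.1.2] at h1
    omega

theorem exists_word_of_coeffV_ne_zero {w : Word n (mEta n)} (hw : WordBlk n blk w) {z y : Z0 n}
    (h : coeffV y (ddWordV n w (T n z)) ≠ 0) :
    ∃ u : Word n (mEta n), WordBlk n blk u ∧ u.length ≤ w.length ∧
      y = permZ0 n (wordPerm n (mEta n) u) z := by
  induction w generalizing y with
  | nil =>
    rw [ddWordV_nil, coeffV_T] at h
    refine ⟨[], hw, le_rfl, ?_⟩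
    by_contra hne
    exact h (if_neg fun e => hne e.symm)
  | cons s w ih =>
    rw [wordBlk_cons] at hw
    rw [ddWordV_cons, ddV_letter, map_smul, map_sub, coeffV_sact] at h
    by_cases h1 : coeffV y (ddWordV n w (T n z)) = 0
    · have h2 : coeffV ((permZ0 n (letterPerm s)).symm y) (ddWordV n w (T n z)) ≠ 0 := by
        intro h2
        rw [h1, h2, map_zero, sub_zero, smul_zero] at h
        exact h rfl
      obtain ⟨u, hu1, hu2, hu3⟩ := ih hw.2 h2
      refine ⟨s :: u, wordBlk_cons.2 ⟨hw.1, hu1⟩, Nat.succ_le_succ hu2, ?_⟩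
      rw [wordPerm_cons, permZ0_mul, ← hu3, Equiv.apply_symm_apply]
    · obtain ⟨u, hu1, hu2, hu3⟩ := ih hw.2 h1
      exact ⟨u, hu1, hu2.trans (Nat.le_succ _), hu3⟩

theorem coeffV_ddWordV_ne_zero {z : Z0 n}
    (hz : ∀ σ ∈ SgEta n blk, ∀ τ ∈ SgEta n blk, permZ0 n σ z = permZ0 n τ z → σ = τ)
    {w : Word n (mEta n)} (hw : WordBlk n blk w)
    (hmin : ∀ u : Word n (mEta n), wordPerm n (mEta n) u = wordPerm n (mEta n) w →
      w.length ≤ u.length) :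
    coeffV (permZ0 n (wordPerm n (mEta n) w) z) (ddWordV n w (T n z)) ≠ 0 := by
  induction w with
  | nil =>
    rw [ddWordV_nil, coeffV_T, wordPerm_nil, permZ0_one, if_pos rfl]
    exact one_ne_zero
  | cons s w ih =>
    have hsw := hw
    rw [wordBlk_cons] at hw
    have ih := ih hw.2 fun u hu => by
      have h1 := hmin (s :: u) (by rw [wordPerm_cons, wordPerm_cons, hu])
      simpa using h1
    have h0 : coeffV (permZ0 n (wordPerm n (mEta n) (s :: w)) z) (ddWordV n w (T n z)) = 0 := by
      by_contra hne
      obtain ⟨u, hu1, hu2, hu3⟩ := exists_word_of_coeffV_ne_zero hw.2 hne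
      have h1 := hmin u (hz _ (wordPerm_mem hsw) _ (wordPerm_mem hu1) hu3).symm
      rw [List.length_cons] at h1
      omega
    rw [ddWordV_cons, ddV_letter, map_smul, map_sub, h0, coeffV_sact, wordPerm_cons, permZ0_mul,
      Equiv.symm_apply_apply, zero_sub, smul_eq_mul]
    refine mul_ne_zero (inv_ne_zero (toK_ne_zero (root_ne_zero s))) (neg_ne_zero.2 ?_)
    exact (map_ne_zero _).2 ih

theorem exists_free_point (htop : ∀ (k : Fin n) (i j : Fin ((k : ℕ) + 1)), (k : ℕ) + 1 = n →
      blk ⟨k, i⟩ = blk ⟨k, j⟩ → i = j) :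
    ∃ z : Z0 n, ∀ σ ∈ SgEta n blk, ∀ τ ∈ SgEta n blk, permZ0 n σ z = permZ0 n τ z → σ = τ := by
  refine ⟨⟨fun p => if (p.1 : ℕ) + 1 = n then 0 else (p.2 : ℕ), fun p hp => if_pos hp⟩, ?_⟩
  intro σ hσ τ hτ h
  funext k
  by_cases hk : (k : ℕ) + 1 = n
  · ext i
    exact congrArg Fin.val
      (htop k _ _ hk ((mem_SgEta.1 hσ k i).trans (mem_SgEta.1 hτ k i).symm))
  · have h1 : (σ k)⁻¹ = (τ k)⁻¹ := by
      ext i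
      have h2 := congrArg (fun y : Z0 n => (y : IdxN n → ℤ) ⟨k, i⟩) h
      simp only [permZ0, permIdx, Equiv.coe_fn_mk, Equiv.coe_fn_symm_mk, if_neg hk] at h2
      exact_mod_cast h2
    exact inv_injective h1

theorem exists_ddPWord_vdm_eq_C (hm : BlkMono blk) (hi : WordIndep blk)
    (htop : ∀ (k : Fin n) (i j : Fin ((k : ℕ) + 1)), (k : ℕ) + 1 = n →
      blk ⟨k, i⟩ = blk ⟨k, j⟩ → i = j) :
    ∃ w : Word n (mEta n), WordBlk n blk w ∧
      ∃ c : ℂ, c ≠ 0 ∧ ddPWord w (vdm blk) = MvPolynomial.C c := by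
  obtain ⟨σ, hσ, hlen⟩ := exists_len_eq_maxLen hm
  obtain ⟨w, ⟨hw1, hw2⟩, hw⟩ := exists_reduced hm hσ
  have hdeg : (ddPWord w (vdm blk)).totalDegree = 0 := by
    have h1 := totalDegree_ddPWord_le w (vdm blk)
    have h2 := totalDegree_pairProd_le (blkPairs blk)
    have h3 : w.length = ∑ k, (blkPairs blk k).card := hw2.trans hlen
    rw [← vdm] at h2
    omega
  rw [MvPolynomial.totalDegree_eq_zero_iff_eq_C] at hdeg
  refine ⟨w, hw, _, ?_, hdeg⟩
  intro hc
  rw [hc, map_zero] at hdeg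
  obtain ⟨z, hz⟩ := exists_free_point htop
  have hinv : ∀ τ ∈ SgEta n blk, sact n τ (ddWordV n w (T n z)) = ddWordV n w (T n z) := by
    intro τ hτ
    refine SgEta_induction (P := fun τ => sact n τ (ddWordV n w (T n z)) = ddWordV n w (T n z))
      hm (sact_one _) (fun s hs τ _ ih => ?_) hτ
    rw [sact_mul, ih]
    refine sact_of_ddV_eq_zero ?_
    rw [← ddWordV_cons]
    refine ddWordV_eq_zero_of_maxLen_lt hm hi (wordBlk_cons.2 ⟨hs, hw⟩) ?_ _
    rw [List.length_cons, hw2, hlen]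
    exact Nat.lt_succ_self _
  have h1 := symSum_ddWordV hw (T n z)
  rw [hdeg, map_zero, zero_div, zero_smul, map_zero, symSum_of_invariant hinv] at h1
  have h2 : (etaFactB n blk : KK n) ≠ 0 := by
    have h3 := (map_ne_zero (algebraMap ℂ (KK n))).2 (etaFactB_ne_zero blk)
    rwa [map_natCast] at h3
  have h4 := (smul_eq_zero_iff_right h2).1 h1
  refine coeffV_ddWordV_ne_zero hz hw (fun u hu => ?_) (by rw [h4, map_zero])
  rw [hw2, ← hw1, ← hu]
  exact len_wordPerm_le u

end Words

section Lattice

variable {n : ℕ} {blk : IdxN n → ℕ}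

theorem toK_mem_Balg (p : PolN n) : toK p ∈ Balg n blk :=
  ⟨p, 1, one_mem _, by rw [map_one, mul_one]⟩

theorem smul_mem_of_mem_Balg {N : Submodule ↥(Balg n blk) (VK n)} {f : KK n}
    (hf : f ∈ Balg n blk) {x : VK n} (hx : x ∈ N) : f • x ∈ N :=
  N.smul_mem ⟨f, hf⟩ hx

theorem algebraMap_smul_mem {N : Submodule ↥(Balg n blk) (VK n)} (c : ℂ) {x : VK n}
    (hx : x ∈ N) : algebraMap ℂ (KK n) c • x ∈ N :=
  smul_mem_of_mem_Balg ((Balg n blk).algebraMap_mem c) hx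

theorem mem_of_natCast_smul_mem {N : Submodule ↥(Balg n blk) (VK n)} {m : ℕ} (hm : (m : ℂ) ≠ 0)
    {x : VK n} (hx : m • x ∈ N) : x ∈ N := by
  have h1 := algebraMap_smul_mem (m : ℂ)⁻¹ hx
  rwa [← Nat.cast_smul_eq_nsmul (KK n), smul_smul, ← map_natCast (algebraMap ℂ (KK n)) m,
    ← map_mul, inv_mul_cancel₀ hm, map_one, one_smul] at h1

theorem symSum_smul_sub_symSum_act_smul_mem (hm : BlkMono blk)
    {N : Submodule ↥(Balg n blk) (VK n)} {y : VK n}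
    (hy : ∀ s : SimpleDat n (mEta n), LetterBlk blk s → ∀ p : PolN n,
      symSum blk (toK p • ddV n s.1 s.2.1 s.2.2 y) ∈ N)
    {τ : SgN n} (hτ : τ ∈ SgEta n blk) (p : PolN n) :
    symSum blk (toK p • y) - symSum blk (toK (actP n (mEta n) τ p) • y) ∈ N := by
  refine SgEta_induction (P := fun τ => symSum blk (toK p • y) -
    symSum blk (toK (actP n (mEta n) τ p) • y) ∈ N) hm ?_ (fun s hs τ _ ih => ?_) hτ
  · rw [actP_one, sub_self]
    exact N.zero_mem
  · set q := actP n (mEta n) τ p with hq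
    have h1 : symSum blk (toK (actP n (mEta n) (letterPerm s) q) • y) =
        symSum blk (toK q • sact n (letterPerm s) y) := by
      rw [← symSum_sact (letterPerm_mem hs), sact_smul, actF_algebraMap, ← actP_mul,
        letterPerm_mul_self, actP_one]
    have h2 := hy s hs (q * root s)
    rw [map_mul, mul_smul, root_smul_ddV, smul_sub, map_sub, ← h1] at h2
    have h3 := N.add_mem ih h2
    rwa [sub_add_sub_cancel, ← actP_mul] at h3

/-- The sum of the conjugates of a polynomial under the block-preserving permutations. -/
def orbitSum (blk : IdxN n → ℕ) (p : PolN n) : PolN n :=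
  ∑ τ ∈ SgFin blk, actP n (mEta n) τ p

theorem actF_toK_orbitSum {σ : SgN n} (hσ : σ ∈ SgEta n blk) (p : PolN n) :
    actF n (mEta n) σ (toK (orbitSum blk p)) = toK (orbitSum blk p) := by
  rw [actF_algebraMap, orbitSum, map_sum]
  simp only [← actP_mul]
  rw [sum_SgFin_mul_left hσ fun τ => actP n (mEta n) τ p]

theorem symSum_smul_mem_of_ddV (hm : BlkMono blk)
    {N : Submodule ↥(Balg n blk) (VK n)} {y : VK n} (h0 : symSum blk y ∈ N)
    (hy : ∀ s : SimpleDat n (mEta n), LetterBlk blk s → ∀ p : PolN n,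
      symSum blk (toK p • ddV n s.1 s.2.1 s.2.2 y) ∈ N) (p : PolN n) :
    symSum blk (toK p • y) ∈ N := by
  have h1 : ∑ τ ∈ SgFin blk, (symSum blk (toK p • y) -
      symSum blk (toK (actP n (mEta n) τ p) • y)) ∈ N :=
    N.sum_mem fun τ hτ => symSum_smul_sub_symSum_act_smul_mem hm hy (mem_SgFin.1 hτ) p
  rw [Finset.sum_sub_distrib, Finset.sum_const, ← map_sum, ← Finset.sum_smul, ← map_sum] at h1
  change _ - symSum blk (toK (orbitSum blk p) • y) ∈ N at h1
  rw [symSum_smul fun σ hσ => actF_toK_orbitSum hσ p] at h1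
  have h2 := N.add_mem h1 (smul_mem_of_mem_Balg (toK_mem_Balg (orbitSum blk p)) h0)
  rw [sub_add_cancel] at h2
  refine mem_of_natCast_smul_mem ?_ h2
  rw [← etaFactB_eq]
  exact etaFactB_ne_zero blk

theorem symSum_smul_ddWordV_mem (hm : BlkMono blk) (hi : WordIndep blk)
    {N : Submodule ↥(Balg n blk) (VK n)} {x : VK n}
    (hx : ∀ w : Word n (mEta n), WordBlk n blk w → symSum blk (ddWordV n w x) ∈ N)
    {w : Word n (mEta n)} (hw : WordBlk n blk w) (p : PolN n) :
    symSum blk (toK p • ddWordV n w x) ∈ N := by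
  obtain ⟨m, hlen⟩ : ∃ m, maxLen blk < w.length + m := ⟨maxLen blk + 1, by omega⟩
  induction m generalizing w p with
  | zero =>
    rw [ddWordV_eq_zero_of_maxLen_lt hm hi hw hlen, smul_zero, map_zero]
    exact N.zero_mem
  | succ m ih =>
    refine symSum_smul_mem_of_ddV hm (hx w hw) (fun s hs q => ?_) p
    refine ih (wordBlk_cons.2 ⟨hs, hw⟩) q ?_
    rw [List.length_cons]
    omega

theorem ddWordV_add (w : Word n (mEta n)) (x y : VK n) :
    ddWordV n w (x + y) = ddWordV n w x + ddWordV n w y := by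
  induction w with
  | nil => rfl
  | cons s w ih => rw [ddWordV_cons, ih, ddV_add]; rfl

theorem symSum_smul_ddWordV_smul_ddWordV_mem (hm : BlkMono blk) (hi : WordIndep blk)
    {N : Submodule ↥(Balg n blk) (VK n)} {x : VK n}
    (hx : ∀ w : Word n (mEta n), WordBlk n blk w → symSum blk (ddWordV n w x) ∈ N)
    {w u : Word n (mEta n)} (hw : WordBlk n blk w) (hu : WordBlk n blk u) (p q : PolN n) :
    symSum blk (toK q • ddWordV n w (toK p • ddWordV n u x)) ∈ N := by
  induction w using List.reverseRecOn generalizing u p with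
  | nil =>
    rw [ddWordV_nil, smul_smul, ← map_mul]
    exact symSum_smul_ddWordV_mem hm hi hx hu _
  | append_singleton w s ih =>
    have hws := wordBlk_concat.1 hw
    have h1 : ddWordV n (w ++ [s]) (toK p • ddWordV n u x) =
        ddWordV n w (toK (actP n (mEta n) (letterPerm s) p) • ddWordV n (s :: u) x) +
          ddWordV n w (toK (ddP s p) • ddWordV n u x) := by
      rw [ddWordV_append, ← ddWordV_add, ddWordV_cons s u x, ← ddV_smul]
      rfl
    rw [h1, smul_add, map_add]
    exact N.add_mem (ih hws.1 (wordBlk_cons.2 ⟨hws.2, hu⟩) _) (ih hws.1 hu _)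

variable (blk) in
/-- The lattice spanned by the symmetrizations of tableaux with coefficients having at most
simple poles along the block roots. -/
def poleLattice : Submodule ↥(Balg n blk) (VK n) :=
  Submodule.span ↥(Balg n blk)
    {x | ∃ (h : PolN n) (z : Z0 n), x = symSum blk ((toK h / toK (vdm blk)) • T n z)}

theorem symSum_mem_poleLattice (h : PolN n) (z : Z0 n) :
    symSum blk ((toK h / toK (vdm blk)) • T n z) ∈ poleLattice blk :=
  Submodule.subset_span ⟨h, z, rfl⟩

theorem symSum_div_smul_mem (hm : BlkMono blk) (hi : WordIndep blk)
    (htop : ∀ (k : Fin n) (i j : Fin ((k : ℕ) + 1)), (k : ℕ) + 1 = n →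
      blk ⟨k, i⟩ = blk ⟨k, j⟩ → i = j)
    {N : Submodule ↥(Balg n blk) (VK n)} {x : VK n}
    (hx : ∀ w : Word n (mEta n), WordBlk n blk w → symSum blk (ddWordV n w x) ∈ N)
    (h : PolN n) : symSum blk ((toK h / toK (vdm blk)) • x) ∈ N := by
  obtain ⟨w, hw, c, hc, hwc⟩ := exists_ddPWord_vdm_eq_C hm hi htop
  have h1 := symSum_smul_ddWordV_smul_ddWordV_mem hm hi hx hw
    (u := []) (fun s hs => absurd hs List.not_mem_nil) (MvPolynomial.C c⁻¹ * h) 1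
  rw [map_one, one_smul, symSum_ddWordV hw, hwc, smul_smul, ddWordV_nil] at h1
  convert h1 using 4
  rw [div_mul_eq_mul_div, ← map_mul, ← mul_assoc, ← map_mul, mul_inv_cancel₀ hc, map_one, one_mul]

theorem span_symV_eq_poleLattice (hm : BlkMono blk)
    (htop : ∀ (k : Fin n) (i j : Fin ((k : ℕ) + 1)), (k : ℕ) + 1 = n →
      blk ⟨k, i⟩ = blk ⟨k, j⟩ → i = j)
    {PdV : SgN n → VK n → VK n}
    (hPdV : ∀ σ ∈ SgEta n blk, ∀ w : Word n (mEta n), IsRedB n blk σ w →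
      ∀ x : VK n, PdV σ x = ddWordV n w x) :
    Submodule.span ↥(Balg n blk)
      {x : VK n | ∃ σ ∈ SgEta n blk, ∃ z : Z0 n, x = symV n blk (PdV σ (T n z))} =
        poleLattice blk := by
  have hi : WordIndep blk := fun σ hσ w w' hw hw' x => by
    rw [← hPdV σ hσ w hw, hPdV σ hσ w' hw']
  apply le_antisymm
  · rw [Submodule.span_le]
    rintro _ ⟨σ, hσ, z, rfl⟩
    obtain ⟨w, hw⟩ := exists_reduced hm hσ
    rw [hPdV σ hσ w hw, symV_eq, symSum_ddWordV hw.2]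
    exact algebraMap_smul_mem _ (symSum_mem_poleLattice _ _)
  · rw [poleLattice, Submodule.span_le]
    rintro _ ⟨h, z, rfl⟩
    refine symSum_div_smul_mem hm hi htop (fun w hw => ?_) h
    rcases ddWordV_eq_zero_or_reduced hm hi hw with h0 | hred
    · rw [h0, map_zero]
      exact Submodule.zero_mem _
    · have h1 : symV n blk (PdV (wordPerm n (mEta n) w) (T n z)) ∈ Submodule.span ↥(Balg n blk)
          {x : VK n | ∃ σ ∈ SgEta n blk, ∃ z : Z0 n, x = symV n blk (PdV σ (T n z))} :=
        Submodule.subset_span ⟨_, wordPerm_mem hw, z, rfl⟩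
      rw [hPdV _ (wordPerm_mem hw) w hred, symV_eq] at h1
      have h2 := algebraMap_smul_mem (etaFactB n blk : ℂ) h1
      rwa [smul_smul, ← map_mul, mul_inv_cancel₀ (etaFactB_ne_zero blk), map_one, one_smul] at h2

end Lattice

section Refinement

variable {n : ℕ} {blkθ blkη : IdxN n → ℕ}

/-- The block function `blkη` refines `blkθ`. -/
def Refines (blkη blkθ : IdxN n → ℕ) : Prop :=
  ∀ p q : IdxN n, p.1 = q.1 → blkη p = blkη q → blkθ p = blkθ q

theorem Refines.SgEta_le (href : Refines blkη blkθ) : SgEta n blkη ≤ SgEta n blkθ :=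
  fun _ hσ p => href _ _ rfl (hσ p)

theorem Refines.SgFin_subset (href : Refines blkη blkθ) : SgFin blkη ⊆ SgFin blkθ :=
  fun _ hσ => mem_SgFin.2 (href.SgEta_le (mem_SgFin.1 hσ))

theorem Refines.BMon_le (href : Refines blkη blkθ) : BMon n blkθ ≤ BMon n blkη := by
  refine Submonoid.closure_mono (Set.union_subset_union_right _ ?_)
  rintro _ ⟨k, i, j, hne, rfl⟩
  exact ⟨k, i, j, fun h => hne (href _ _ rfl h), rfl⟩

theorem Refines.Balg_le (href : Refines blkη blkθ) : Balg n blkθ ≤ Balg n blkη := by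
  rintro f ⟨p, q, hq, h⟩
  exact ⟨p, q, href.BMon_le hq, h⟩

theorem BMon_ne_zero {blk : IdxN n → ℕ} {q : PolN n} (hq : q ∈ BMon n blk) : q ≠ 0 := by
  refine Submonoid.closure_induction (fun x hx => ?_) one_ne_zero
    (fun x y _ _ hx hy => mul_ne_zero hx hy) hq
  rcases hx with ⟨k, i, j, c, -, hij, -, rfl⟩ | ⟨k, i, j, hne, rfl⟩
  · intro h0
    have h1 := congrArg (MvPolynomial.eval fun p : IdxN n => if p = ⟨k, i⟩ then (c : ℂ) + 1 else 0) h0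
    have h2 : (⟨k, j⟩ : IdxN n) ≠ ⟨k, i⟩ := fun h => hij.ne' (eq_of_heq (Sigma.mk.inj h).2)
    simp [h2] at h1
  · exact X_sub_X_ne_zero fun h => hne (congrArg blk h)

theorem inv_toK_mem_Balg {blk : IdxN n → ℕ} {q : PolN n} (hq : q ∈ BMon n blk) :
    (toK q)⁻¹ ∈ Balg n blk :=
  ⟨1, q, hq, by rw [map_one, inv_mul_cancel₀ (toK_ne_zero (BMon_ne_zero hq))]⟩

/-- Pairs of positions in a common `blkθ`-block and in increasing `blkη`-blocks. -/
def crossPairs (blkθ blkη : IdxN n → ℕ) (k : Fin n) : Finset (Fin (mEta n k) × Fin (mEta n k)) :=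
  Finset.univ.filter fun p => blkθ ⟨k, p.1⟩ = blkθ ⟨k, p.2⟩ ∧ blkη ⟨k, p.1⟩ < blkη ⟨k, p.2⟩

theorem mem_crossPairs {k : Fin n} {p : Fin (mEta n k) × Fin (mEta n k)} :
    p ∈ crossPairs blkθ blkη k ↔
      blkθ ⟨k, p.1⟩ = blkθ ⟨k, p.2⟩ ∧ blkη ⟨k, p.1⟩ < blkη ⟨k, p.2⟩ := by
  simp [crossPairs]

theorem vdm_eq_mul_pairProd_crossPairs (hmη : BlkMono blkη) (href : Refines blkη blkθ) :
    vdm blkθ = vdm blkη * pairProd (crossPairs blkθ blkη) := by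
  rw [vdm, vdm, pairProd, pairProd, pairProd, ← Finset.prod_mul_distrib]
  refine Finset.prod_congr rfl fun k _ => ?_
  rw [← Finset.prod_union]
  · refine Finset.prod_congr (Finset.ext fun p => ?_) fun _ _ => rfl
    rw [Finset.mem_union, mem_blkPairs, mem_blkPairs, mem_crossPairs]
    constructor
    · rintro ⟨h1, h2⟩
      rcases (hmη k h1.le).lt_or_eq with h | h
      · exact Or.inr ⟨h2, h⟩
      · exact Or.inl ⟨h1, h⟩
    · rintro (⟨h1, h2⟩ | ⟨h1, h2⟩)
      · exact ⟨h1, href _ _ rfl h2⟩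
      · exact ⟨lt_of_not_ge fun h => (hmη k h).not_gt h2, h1⟩
  · rw [Finset.disjoint_left]
    intro p h1 h2
    exact (mem_crossPairs.1 h2).2.ne (mem_blkPairs.1 h1).2

theorem pairProd_crossPairs_mem_BMon : pairProd (crossPairs blkθ blkη) ∈ BMon n blkη :=
  prod_mem fun k _ => prod_mem fun p hp =>
    Submonoid.subset_closure (Or.inr ⟨k, p.1, p.2, (mem_crossPairs.1 hp).2.ne, rfl⟩)

theorem prod_crossPairs_act {σ τ : SgN n} (href : Refines blkη blkθ) (hσ : σ ∈ SgEta n blkη)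
    (hτ : τ ∈ SgEta n blkη) :
    ∏ k, ∏ p ∈ crossPairs blkθ blkη k,
      (MvPolynomial.X (⟨k, σ k p.1⟩ : IdxN n) - MvPolynomial.X (⟨k, τ k p.2⟩ : IdxN n)) =
      pairProd (crossPairs blkθ blkη) := by
  refine Finset.prod_congr rfl fun k _ => ?_
  have hmem : ∀ α ∈ SgEta n blkη, ∀ β ∈ SgEta n blkη, ∀ p ∈ crossPairs blkθ blkη k,
      (α k p.1, β k p.2) ∈ crossPairs blkθ blkη k := by
    intro α hα β hβ p hp
    obtain ⟨h1, h2⟩ := mem_crossPairs.1 hp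
    refine mem_crossPairs.2 ⟨?_, ?_⟩
    · exact ((mem_SgEta.1 (href.SgEta_le hα) k _).trans h1).trans
        (mem_SgEta.1 (href.SgEta_le hβ) k _).symm
    · rwa [mem_SgEta.1 hα k, mem_SgEta.1 hβ k]
  refine Finset.prod_nbij' (fun p => (σ k p.1, τ k p.2))
    (fun p => (σ⁻¹ k p.1, τ⁻¹ k p.2)) (hmem σ hσ τ hτ) (hmem _ (inv_mem hσ) _ (inv_mem hτ))
    ?_ ?_ ?_
  · intro p _; simp
  · intro p _; simp
  · intro p _; rfl

theorem actP_pairProd_crossPairs {σ : SgN n} (href : Refines blkη blkθ) (hσ : σ ∈ SgEta n blkη) :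
    actP n (mEta n) σ (pairProd (crossPairs blkθ blkη)) = pairProd (crossPairs blkθ blkη) := by
  rw [actP_pairProd, prod_crossPairs_act href hσ hσ]

theorem prod_crossPairs_eq_zero {τ : SgN n} (hτ : τ ∈ SgEta n blkθ) (hτ' : τ ∉ SgEta n blkη) :
    ∏ k, ∏ p ∈ crossPairs blkθ blkη k,
      (MvPolynomial.X ⟨k, p.1⟩ - MvPolynomial.X ⟨k, τ k p.2⟩ : PolN n) = 0 := by
  obtain ⟨k, j, hlt⟩ : ∃ (k : Fin n) (j : Fin (mEta n k)), blkη ⟨k, τ k j⟩ < blkη ⟨k, j⟩ := by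
    by_contra! hle
    refine hτ' (mem_SgEta.2 fun k i => ?_)
    have h1 : ∑ j, blkη ⟨k, j⟩ = ∑ j, blkη ⟨k, τ k j⟩ :=
      (Equiv.sum_comp (τ k) fun j => blkη ⟨k, j⟩).symm
    rw [Finset.sum_eq_sum_iff_of_le fun j _ => hle k j] at h1
    exact (h1 i (Finset.mem_univ i)).symm
  refine Finset.prod_eq_zero (Finset.mem_univ k)
    (Finset.prod_eq_zero (i := (τ k j, j)) (mem_crossPairs.2 ⟨?_, hlt⟩) (sub_self _))
  exact mem_SgEta.1 hτ k j

theorem symSum_mem_poleLattice_of_refines (hmθ : BlkMono blkθ) (hmη : BlkMono blkη)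
    (href : Refines blkη blkθ) (h : PolN n) (z : Z0 n) :
    symSum blkθ ((toK h / toK (vdm blkθ)) • T n z) ∈ poleLattice blkη := by
  set u : VK n := (toK h / toK (vdm blkθ)) • T n z with hu
  have h1 : (SgFin blkη).card • symSum blkθ u =
      ∑ τ ∈ SgFin blkθ, symSum blkη (sact n τ u) := by
    rw [← Finset.sum_const]
    simp only [symSum_apply blkη]
    rw [Finset.sum_comm]
    refine Finset.sum_congr rfl fun σ hσ => ?_
    simp only [← sact_mul]
    rw [sum_SgFin_mul_left (href.SgEta_le (mem_SgFin.1 hσ)) fun τ => sact n τ u, symSum_apply]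
  refine mem_of_natCast_smul_mem (m := (SgFin blkη).card) ?_ ?_
  · rw [← etaFactB_eq]
    exact etaFactB_ne_zero blkη
  rw [h1]
  refine Submodule.sum_mem _ fun τ hτ => ?_
  have hinv : ∀ σ ∈ SgEta n blkη, actF n (mEta n) σ (toK (pairProd (crossPairs blkθ blkη)))⁻¹ =
      (toK (pairProd (crossPairs blkθ blkη)))⁻¹ := fun σ hσ => by
    rw [map_inv₀, actF_algebraMap, actP_pairProd_crossPairs href hσ]
  have hfac : ∃ g : PolN n, sact n τ u = (toK (pairProd (crossPairs blkθ blkη)))⁻¹ •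
      (toK g / toK (vdm blkη)) • T n (permZ0 n τ z) := by
    have hv : vdm blkθ = vdm blkη * pairProd (crossPairs blkθ blkη) :=
      vdm_eq_mul_pairProd_crossPairs hmη href
    rcases actP_vdm hmθ (mem_SgFin.1 hτ) with h2 | h2
    · refine ⟨actP n (mEta n) τ h, ?_⟩
      rw [hu, sact_smul, sact_T, map_div₀, actF_algebraMap, actF_algebraMap, h2, hv, map_mul,
        smul_smul]
      congr 1
      field_simp
    · refine ⟨-actP n (mEta n) τ h, ?_⟩
      rw [hu, sact_smul, sact_T, map_div₀, actF_algebraMap, actF_algebraMap, h2, hv, map_neg,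
        map_mul, map_neg, smul_smul]
      congr 1
      field_simp
  obtain ⟨g, hg⟩ := hfac
  rw [hg, symSum_smul hinv]
  exact smul_mem_of_mem_Balg (inv_toK_mem_Balg pairProd_crossPairs_mem_BMon)
    (symSum_mem_poleLattice _ _)

theorem sum_prod_smul_sact_mem_poleLattice {blk : IdxN n → ℕ}
    (F : Finset ((k : Fin n) × (Fin (mEta n k) × Fin (mEta n k)))) (h : PolN n) (z : Z0 n) :
    ∑ τ ∈ SgFin blk, toK (∏ t ∈ F, (MvPolynomial.X (⟨t.1, t.2.1⟩ : IdxN n) -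
      MvPolynomial.X (⟨t.1, τ t.1 t.2.2⟩ : IdxN n))) •
        sact n τ ((toK h / toK (vdm blk)) • T n z) ∈ poleLattice blk := by
  classical
  induction F using Finset.induction_on generalizing h with
  | empty =>
    simp only [Finset.prod_empty, map_one, one_smul]
    rw [← symSum_apply]
    exact symSum_mem_poleLattice h z
  | insert t F ht ih =>
    have h1 := Submodule.sub_mem _
      (smul_mem_of_mem_Balg (toK_mem_Balg (MvPolynomial.X (⟨t.1, t.2.1⟩ : IdxN n))) (ih h))
      (ih (MvPolynomial.X (⟨t.1, t.2.2⟩ : IdxN n) * h))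
    rw [Finset.smul_sum, ← Finset.sum_sub_distrib] at h1
    convert h1 using 1
    refine Finset.sum_congr rfl fun τ _ => ?_
    rw [Finset.prod_insert ht, map_mul, map_mul, mul_div_assoc, mul_smul (toK _) _ (T n z),
      sact_smul _ (toK _) (_ • T n z), actF_algebraMap, actP_X, smul_smul, smul_smul, ← sub_smul]
    congr 1
    rw [map_sub, sub_mul]
    congr 1
    exact mul_comm _ _

theorem symSum_mem_poleLattice_of_refined (hmη : BlkMono blkη)
    (href : Refines blkη blkθ) (h : PolN n) (z : Z0 n) :
    symSum blkη ((toK h / toK (vdm blkη)) • T n z) ∈ poleLattice blkθ := by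
  have h1 := sum_prod_smul_sact_mem_poleLattice (blk := blkθ)
    (Finset.univ.sigma (crossPairs blkθ blkη)) h z
  simp only [Finset.prod_sigma] at h1
  rw [← Finset.sum_subset href.SgFin_subset fun τ hτ hτ' => by
    rw [prod_crossPairs_eq_zero (mem_SgFin.1 hτ) fun h => hτ' (mem_SgFin.2 h), map_zero,
      zero_smul]] at h1
  convert h1 using 1
  rw [symSum_apply]
  refine Finset.sum_congr rfl fun τ hτ => ?_
  have hτ := mem_SgFin.1 hτ
  have h2 := prod_crossPairs_act href (one_mem _) hτ
  simp only [Pi.one_apply, Equiv.Perm.coe_one, id_eq] at h2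
  rw [h2, ← actP_pairProd_crossPairs href hτ, ← actF_algebraMap, ← sact_smul, smul_smul,
    vdm_eq_mul_pairProd_crossPairs hmη href, map_mul]
  congr 2
  have hD := toK_ne_zero (BMon_ne_zero (pairProd_crossPairs_mem_BMon (blkθ := blkθ) (blkη := blkη)))
  field_simp

theorem span_poleLattice (hmθ : BlkMono blkθ) (hmη : BlkMono blkη) (href : Refines blkη blkθ) :
    Submodule.span ↥(Balg n blkη) (poleLattice blkθ : Set (VK n)) = poleLattice blkη := by
  apply le_antisymm
  · rw [Submodule.span_le]
    intro x hx
    refine Submodule.span_induction (fun y hy => ?_) (Submodule.zero_mem _)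
      (fun y y' _ _ hy hy' => Submodule.add_mem _ hy hy')
      (fun b y _ hy => smul_mem_of_mem_Balg (href.Balg_le b.2) hy) hx
    obtain ⟨h, z, rfl⟩ := hy
    exact symSum_mem_poleLattice_of_refines hmθ hmη href h z
  · rw [poleLattice, Submodule.span_le]
    rintro _ ⟨h, z, rfl⟩
    exact Submodule.subset_span (symSum_mem_poleLattice_of_refined hmη href h z)

end Refinement

section Fibre

variable {n : ℕ} {blkθ blkη : IdxN n → ℕ}

theorem eval_ne_zero_of_mem_BMon {blk : IdxN n → ℕ} {v : IdxN n → ℂ}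
    {φ : ↥(Balg n blk) →ₐ[ℂ] ℂ}
    (hφ : ∀ (p : PolN n) (hp : toK p ∈ Balg n blk), φ ⟨toK p, hp⟩ = MvPolynomial.eval v p)
    {q : PolN n} (hq : q ∈ BMon n blk) : MvPolynomial.eval v q ≠ 0 := by
  intro h0
  rw [← hφ q (toK_mem_Balg q)] at h0
  have h1 : (⟨toK q, toK_mem_Balg q⟩ : ↥(Balg n blk)) * ⟨(toK q)⁻¹, inv_toK_mem_Balg hq⟩ = 1 :=
    Subtype.ext (mul_inv_cancel₀ (toK_ne_zero (BMon_ne_zero hq)))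
  have h2 := congrArg φ h1
  rw [map_mul, h0, zero_mul, map_one] at h2
  exact zero_ne_one h2

theorem exists_sub_mem_span {blk : IdxN n → ℕ} (φ : ↥(Balg n blk) →ₐ[ℂ] ℂ)
    {L' : Submodule ↥(Balg n blkθ) (VK n)} {L : Submodule ↥(Balg n blk) (VK n)}
    (hL : Submodule.span ↥(Balg n blk) (L' : Set (VK n)) = L) {w : VK n} (hw : w ∈ L) :
    ∃ w' ∈ L', w - w' ∈ Submodule.span ↥(Balg n blk)
      {x : VK n | ∃ f : ↥(Balg n blk), ∃ w ∈ L, φ f = 0 ∧ x = (f : KK n) • w} := by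
  subst hL
  induction hw using Submodule.span_induction with
  | mem x hx => exact ⟨x, hx, by rw [sub_self]; exact Submodule.zero_mem _⟩
  | zero => exact ⟨0, Submodule.zero_mem _, by rw [sub_self]; exact Submodule.zero_mem _⟩
  | add x y _ _ hx hy =>
    obtain ⟨x', hx', hx⟩ := hx
    obtain ⟨y', hy', hy⟩ := hy
    refine ⟨x' + y', Submodule.add_mem _ hx' hy', ?_⟩
    rw [add_sub_add_comm]
    exact Submodule.add_mem _ hx hy
  | smul b x hx' hx =>
    obtain ⟨x', hx1, hx2⟩ := hx
    refine ⟨algebraMap ℂ (KK n) (φ b) • x', algebraMap_smul_mem _ hx1, ?_⟩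
    have h1 := Submodule.subset_span (R := ↥(Balg n blk)) (show _ ∈ {y : VK n |
      ∃ f : ↥(Balg n blk), ∃ w ∈ Submodule.span ↥(Balg n blk) (L' : Set (VK n)),
        φ f = 0 ∧ y = (f : KK n) • w} from
      ⟨b - algebraMap ℂ _ (φ b), x, hx', by rw [map_sub, AlgHom.commutes]; exact sub_self _, rfl⟩)
    have h2 := Submodule.add_mem _ h1 (algebraMap_smul_mem (φ b) hx2)
    convert h2 using 1
    change (b : KK n) • x - _ = ((b : KK n) - algebraMap ℂ (KK n) (φ b)) • x + _
    rw [sub_smul, smul_sub]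
    abel

theorem exists_smul_mem_span {v : IdxN n → ℂ}
    {φ : ↥(Balg n blkθ) →ₐ[ℂ] ℂ} {ψ : ↥(Balg n blkη) →ₐ[ℂ] ℂ}
    (hφ : ∀ (p : PolN n) (hp : toK p ∈ Balg n blkθ), φ ⟨toK p, hp⟩ = MvPolynomial.eval v p)
    (hψ : ∀ (p : PolN n) (hp : toK p ∈ Balg n blkη), ψ ⟨toK p, hp⟩ = MvPolynomial.eval v p)
    {Lθ : Submodule ↥(Balg n blkθ) (VK n)} {Lη : Submodule ↥(Balg n blkη) (VK n)}
    (hL : Submodule.span ↥(Balg n blkη) (Lθ : Set (VK n)) = Lη) {w : VK n}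
    (hw : w ∈ Submodule.span ↥(Balg n blkη)
      {x : VK n | ∃ f : ↥(Balg n blkη), ∃ w ∈ Lη, ψ f = 0 ∧ x = (f : KK n) • w}) :
    ∃ q ∈ BMon n blkη, toK q • w ∈ Submodule.span ↥(Balg n blkθ)
      {x : VK n | ∃ f : ↥(Balg n blkθ), ∃ w ∈ Lθ, φ f = 0 ∧ x = (f : KK n) • w} := by
  subst hL
  set Mθ := Submodule.span ↥(Balg n blkθ)
      {x : VK n | ∃ f : ↥(Balg n blkθ), ∃ w ∈ Lθ, φ f = 0 ∧ x = (f : KK n) • w} with hM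
  have hclear : ∀ y ∈ Submodule.span ↥(Balg n blkη) (Lθ : Set (VK n)),
      ∃ q ∈ BMon n blkη, toK q • y ∈ Lθ := by
    intro y hy
    induction hy using Submodule.span_induction with
    | mem x hx => exact ⟨1, one_mem _, by rwa [map_one, one_smul]⟩
    | zero => exact ⟨1, one_mem _, by rw [smul_zero]; exact Submodule.zero_mem _⟩
    | add x y _ _ hx hy =>
      obtain ⟨q, hq, hx⟩ := hx
      obtain ⟨q', hq', hy⟩ := hy
      refine ⟨q * q', mul_mem hq hq', ?_⟩
      have h1 := Submodule.add_mem _ (smul_mem_of_mem_Balg (toK_mem_Balg q') hx)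
        (smul_mem_of_mem_Balg (toK_mem_Balg q) hy)
      rwa [smul_smul, smul_smul, ← map_mul, ← map_mul, mul_comm q' q, ← smul_add] at h1
    | smul b x _ hx =>
      obtain ⟨q, hq, hx⟩ := hx
      obtain ⟨a, r, hr, hb⟩ := b.2
      refine ⟨r * q, mul_mem hr hq, ?_⟩
      have h1 := smul_mem_of_mem_Balg (toK_mem_Balg a) hx
      rw [← hb, smul_smul] at h1
      change toK (r * q) • (b : KK n) • x ∈ Lθ
      rw [smul_smul, map_mul]
      convert h1 using 2
      ring
  induction hw using Submodule.span_induction with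
  | mem x hx =>
    obtain ⟨f, y, hy, hf, rfl⟩ := hx
    obtain ⟨q, hq, hy⟩ := hclear y hy
    obtain ⟨a, r, hr, hb⟩ := f.2
    refine ⟨r * q, mul_mem hr hq, Submodule.subset_span ⟨⟨toK a, toK_mem_Balg a⟩, _, hy, ?_, ?_⟩⟩
    · rw [hφ, ← hψ a (toK_mem_Balg a)]
      have h1 : (⟨toK a, toK_mem_Balg a⟩ : ↥(Balg n blkη)) = f * ⟨toK r, toK_mem_Balg r⟩ :=
        Subtype.ext hb.symm
      rw [h1, map_mul, hf, zero_mul]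
    · change toK (r * q) • (f : KK n) • y = toK a • toK q • y
      rw [smul_smul, smul_smul, ← hb, map_mul]
      congr 1
      ring
  | zero => exact ⟨1, one_mem _, by rw [smul_zero]; exact Submodule.zero_mem _⟩
  | add x y _ _ hx hy =>
    obtain ⟨q, hq, hx⟩ := hx
    obtain ⟨q', hq', hy⟩ := hy
    refine ⟨q * q', mul_mem hq hq', ?_⟩
    have h1 := Submodule.add_mem _ (smul_mem_of_mem_Balg (toK_mem_Balg q') hx)
      (smul_mem_of_mem_Balg (toK_mem_Balg q) hy)
    rwa [smul_smul, smul_smul, ← map_mul, ← map_mul, mul_comm q' q, ← smul_add] at h1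
  | smul b x _ hx =>
    obtain ⟨q, hq, hx⟩ := hx
    obtain ⟨a, r, hr, hb⟩ := b.2
    refine ⟨r * q, mul_mem hr hq, ?_⟩
    have h1 := smul_mem_of_mem_Balg (toK_mem_Balg a) hx
    rw [← hb, smul_smul] at h1
    change toK (r * q) • (b : KK n) • x ∈ Mθ
    rw [smul_smul, map_mul]
    convert h1 using 2
    ring

theorem mem_span_of_smul_mem {blk : IdxN n → ℕ} {v : IdxN n → ℂ} {φ : ↥(Balg n blk) →ₐ[ℂ] ℂ}
    (hφ : ∀ (p : PolN n) (hp : toK p ∈ Balg n blk), φ ⟨toK p, hp⟩ = MvPolynomial.eval v p)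
    {L : Submodule ↥(Balg n blk) (VK n)} {w : VK n} (hw : w ∈ L) {q : PolN n}
    (hq : MvPolynomial.eval v q ≠ 0)
    (h : toK q • w ∈ Submodule.span ↥(Balg n blk)
      {x : VK n | ∃ f : ↥(Balg n blk), ∃ w ∈ L, φ f = 0 ∧ x = (f : KK n) • w}) :
    w ∈ Submodule.span ↥(Balg n blk)
      {x : VK n | ∃ f : ↥(Balg n blk), ∃ w ∈ L, φ f = 0 ∧ x = (f : KK n) • w} := by
  have h1 := Submodule.subset_span (R := ↥(Balg n blk)) (show _ ∈ {x : VK n |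
      ∃ f : ↥(Balg n blk), ∃ w ∈ L, φ f = 0 ∧ x = (f : KK n) • w} from
    ⟨⟨toK (MvPolynomial.C (MvPolynomial.eval v q) - q), toK_mem_Balg _⟩, w, hw,
      by rw [hφ, map_sub, MvPolynomial.eval_C, sub_self], rfl⟩)
  have h2 := algebraMap_smul_mem (MvPolynomial.eval v q)⁻¹ (Submodule.add_mem _ h1 h)
  convert h2 using 1
  change w = _ • (toK (MvPolynomial.C (MvPolynomial.eval v q) - q) • w + _)
  rw [map_sub, sub_smul, sub_add_cancel, smul_smul, IsScalarTower.algebraMap_apply ℂ (PolN n) (KK n),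
    ← map_mul, MvPolynomial.algebraMap_eq, ← map_mul, inv_mul_cancel₀ hq, map_one, map_one, one_smul]

end Fibre

/-- if η refines θ then L_η = B_η·L_θ, and for v fully critical with
singularity η the natural ℂ-linear map ℂ_v ⊗_{B_θ} L_θ → ℂ_v ⊗_{B_η} L_η induced by the
inclusion L_θ ⊆ L_η is an isomorphism.  Identifying ℂ_v ⊗_{B_ζ} L_ζ with L_ζ/M_ζ where
M_ζ = (ker π^ζ_v)·L_ζ, the isomorphism statement says that the induced map is surjective
(∀ w ∈ L_η there is w' ∈ L_θ with w − w' ∈ M_η) and injective (w ∈ L_θ ∩ M_η → w ∈ M_θ). -/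
theorem statement19 (n : ℕ) (blkθ blkη : IdxN n → ℕ)
    (hmonoθ : ∀ k : Fin n, Monotone fun i : Fin ((k : ℕ) + 1) => blkθ ⟨k, i⟩)
    (htopθ : ∀ (k : Fin n) (i j : Fin ((k : ℕ) + 1)), (k : ℕ) + 1 = n →
      blkθ ⟨k, i⟩ = blkθ ⟨k, j⟩ → i = j)
    (hmonoη : ∀ k : Fin n, Monotone fun i : Fin ((k : ℕ) + 1) => blkη ⟨k, i⟩)
    (htopη : ∀ (k : Fin n) (i j : Fin ((k : ℕ) + 1)), (k : ℕ) + 1 = n →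
      blkη ⟨k, i⟩ = blkη ⟨k, j⟩ → i = j)
    -- η is a refinement of θ: each η-block is contained in a θ-block
    (href : ∀ p q : IdxN n, p.1 = q.1 → blkη p = blkη q → blkθ p = blkθ q)
    (PdV : SgN n → VK n → VK n)
    (hPdVθ : ∀ σ ∈ SgEta n blkθ, ∀ w : Word n (mEta n), IsRedB n blkθ σ w →
      ∀ x : VK n, PdV σ x = ddWordV n w x)
    (hPdVη : ∀ σ ∈ SgEta n blkη, ∀ w : Word n (mEta n), IsRedB n blkη σ w →
      ∀ x : VK n, PdV σ x = ddWordV n w x)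
    (v : IdxN n → ℂ)
    (hcrit1 : ∀ (k : Fin n) (i j : Fin ((k : ℕ) + 1)), (k : ℕ) + 1 < n →
      ((∃ c : ℤ, v ⟨k, i⟩ - v ⟨k, j⟩ = (c : ℂ)) ↔ blkη ⟨k, i⟩ = blkη ⟨k, j⟩))
    (hcrit2 : ∀ (k : Fin n) (i j : Fin ((k : ℕ) + 1)),
      blkη ⟨k, i⟩ = blkη ⟨k, j⟩ → v ⟨k, i⟩ = v ⟨k, j⟩)
    (πθ : ↥(Balg n blkθ) →ₐ[ℂ] ℂ)
    (hπθ : ∀ (p : PolN n) (hp : algebraMap (PolN n) (KK n) p ∈ Balg n blkθ),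
      πθ ⟨algebraMap (PolN n) (KK n) p, hp⟩ = MvPolynomial.eval v p)
    (πη : ↥(Balg n blkη) →ₐ[ℂ] ℂ)
    (hπη : ∀ (p : PolN n) (hp : algebraMap (PolN n) (KK n) p ∈ Balg n blkη),
      πη ⟨algebraMap (PolN n) (KK n) p, hp⟩ = MvPolynomial.eval v p) :
    let Lθ : Submodule ↥(Balg n blkθ) (VK n) := Submodule.span ↥(Balg n blkθ)
      {x : VK n | ∃ σ ∈ SgEta n blkθ, ∃ z : Z0 n, x = symV n blkθ (PdV σ (T n z))};
    let Lη : Submodule ↥(Balg n blkη) (VK n) := Submodule.span ↥(Balg n blkη)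
      {x : VK n | ∃ σ ∈ SgEta n blkη, ∃ z : Z0 n, x = symV n blkη (PdV σ (T n z))};
    let Mθ : Submodule ↥(Balg n blkθ) (VK n) := Submodule.span ↥(Balg n blkθ)
      {x : VK n | ∃ f : ↥(Balg n blkθ), ∃ w ∈ Lθ, πθ f = 0 ∧ x = (f : KK n) • w};
    let Mη : Submodule ↥(Balg n blkη) (VK n) := Submodule.span ↥(Balg n blkη)
      {x : VK n | ∃ f : ↥(Balg n blkη), ∃ w ∈ Lη, πη f = 0 ∧ x = (f : KK n) • w};
    -- L_η is the B_η-span of L_θ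
    Submodule.span ↥(Balg n blkη) (Lθ : Set (VK n)) = Lη ∧
    -- the induced map ℂ_v ⊗_{B_θ} L_θ → ℂ_v ⊗_{B_η} L_η is surjective…
    (∀ w ∈ Lη, ∃ w' ∈ Lθ, w - w' ∈ Mη) ∧
    -- …and injective
    (∀ w ∈ Lθ, w ∈ Mη → w ∈ Mθ) := by
  intro Lθ Lη Mθ Mη
  have href' : Refines blkη blkθ := href
  have h1 : Lθ = poleLattice blkθ := span_symV_eq_poleLattice hmonoθ htopθ hPdVθ
  have h2 : Lη = poleLattice blkη := span_symV_eq_poleLattice hmonoη htopη hPdVη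
  have hL : Submodule.span ↥(Balg n blkη) (Lθ : Set (VK n)) = Lη := by
    rw [h1, h2, span_poleLattice hmonoθ hmonoη href']
  refine ⟨hL, fun w hw => exists_sub_mem_span πη hL hw, fun w hw hwM => ?_⟩
  obtain ⟨q, hq, hqw⟩ := exists_smul_mem_span hπθ hπη hL hwM
  exact mem_span_of_smul_mem hπθ hw (eval_ne_zero_of_mem_BMon hπη hq) hqw

end GTpaper

end
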